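/- arXiv:2009.09868 — 3 statements merged into one kernel-verified Lean document; each statement's English description precedes it below -/
import Mathlib

section
/- Let $n > k \geq 1$, $p, r > 1$, $\lambda > 0$, and $\beta < k - k/r$ if $0 < \lambda \leq n - k$, or $\beta < n - \lambda - k/r$ if $\lambda > n - k$. Set $q = r/(r-1)$ and $\gamma = \lambda - k/q + \beta$, and assume $\gamma > 0$. Then for any non-negative measurable function $h$ on $\mathbb{R}^{n-k}$, $\int_{\mathbb{R}^n} \Big( \int_{\mathbb{R}^{n-k}} \frac{h(x)}{|x-y|^{\lambda} |y''|^{\beta}} dx \Big)^q dy \leq \Big( \frac{\lambda \, 2^{2\gamma+1}}{\gamma} \cdot \frac{1}{k/q - \beta} \Big)^q |\mathbb{S}^{k-1}| \int_{\mathbb{R}^{n-k}} \Big( \int_{\mathbb{R}^{n-k}} \frac{h(x)}{|z - x|^{\gamma}} dx \Big)^q dz$. -/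
open MeasureTheory Set

lemma aux_rad1 (s lam γ δ : ℝ) (hs : 0 < s) (hγ : 0 < γ) (hδ : 0 < δ) (hl : lam = γ + δ) :
    ∫⁻ ρ in Ioi (0 : ℝ), ENNReal.ofReal ((s ^ 2 + ρ ^ 2) ^ (-(lam / 2)) * ρ ^ (δ - 1))
      ≤ ENNReal.ofReal (s ^ (-γ) * (lam / (γ * δ))) := by
  have hlam : 0 < lam := by linarith
  have hsq : ∀ t : ℝ, 0 < t → t ^ (-lam) = (t ^ 2) ^ (-(lam / 2)) := by
    intro t ht
    rw [← Real.rpow_natCast t 2, ← Real.rpow_mul ht.le]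
    congr 1
    push_cast
    ring
  have h1 : ∫⁻ ρ in Ioc (0 : ℝ) s,
      ENNReal.ofReal ((s ^ 2 + ρ ^ 2) ^ (-(lam / 2)) * ρ ^ (δ - 1))
      ≤ ENNReal.ofReal (s ^ (-γ) / δ) := by
    have hi : IntegrableOn (fun ρ : ℝ => s ^ (-lam) * ρ ^ (δ - 1)) (Ioc 0 s) := by
      have := (intervalIntegral.intervalIntegrable_rpow' (a := 0) (b := s)
        (r := δ - 1) (by linarith)).1
      exact this.const_mul _
    calc _ ≤ ∫⁻ ρ in Ioc (0 : ℝ) s, ENNReal.ofReal (s ^ (-lam) * ρ ^ (δ - 1)) := by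
          refine setLIntegral_mono' measurableSet_Ioc fun ρ hρ => ?_
          apply ENNReal.ofReal_le_ofReal
          apply mul_le_mul_of_nonneg_right _ (Real.rpow_nonneg hρ.1.le _)
          rw [hsq s hs]
          exact Real.rpow_le_rpow_of_nonpos (by positivity) (by nlinarith [sq_nonneg ρ])
            (by linarith)
      _ = ENNReal.ofReal (∫ ρ in Ioc (0 : ℝ) s, s ^ (-lam) * ρ ^ (δ - 1)) := by
          rw [ofReal_integral_eq_lintegral_ofReal hi]
          filter_upwards [ae_restrict_mem measurableSet_Ioc] with ρ hρ
          have := hρ.1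
          simp only [Pi.zero_apply]
          positivity
      _ = _ := by
          rw [integral_const_mul, ← intervalIntegral.integral_of_le hs.le,
            integral_rpow (Or.inl (by linarith))]
          congr 1
          rw [show δ - 1 + 1 = δ by ring, Real.zero_rpow hδ.ne', sub_zero, ← mul_div_assoc,
            ← Real.rpow_add hs]
          congr 2
          linarith
  have h2 : ∫⁻ ρ in Ioi s,
      ENNReal.ofReal ((s ^ 2 + ρ ^ 2) ^ (-(lam / 2)) * ρ ^ (δ - 1))
      ≤ ENNReal.ofReal (s ^ (-γ) / γ) := by
    have hi : IntegrableOn (fun ρ : ℝ => ρ ^ (-γ - 1)) (Ioi s) :=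
      integrableOn_Ioi_rpow_of_lt (by linarith) hs
    calc _ ≤ ∫⁻ ρ in Ioi s, ENNReal.ofReal (ρ ^ (-γ - 1)) := by
          refine setLIntegral_mono' measurableSet_Ioi fun ρ hρ => ?_
          have hρ0 : 0 < ρ := hs.trans hρ
          apply ENNReal.ofReal_le_ofReal
          rw [show -γ - 1 = -lam + (δ - 1) by linarith, Real.rpow_add hρ0]
          apply mul_le_mul_of_nonneg_right _ (Real.rpow_nonneg hρ0.le _)
          rw [hsq ρ hρ0]
          exact Real.rpow_le_rpow_of_nonpos (by positivity) (by nlinarith [sq_nonneg s])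
            (by linarith)
      _ = ENNReal.ofReal (∫ ρ in Ioi s, ρ ^ (-γ - 1)) := by
          rw [ofReal_integral_eq_lintegral_ofReal hi]
          filter_upwards [ae_restrict_mem measurableSet_Ioi] with ρ hρ
          have : 0 < ρ := hs.trans hρ
          simp only [Pi.zero_apply]
          positivity
      _ = _ := by
          rw [integral_Ioi_rpow_of_lt (by linarith) hs]
          congr 1
          rw [show -γ - 1 + 1 = -γ by ring, neg_div_neg_eq]
  rw [← Ioc_union_Ioi_eq_Ioi hs.le]
  refine (lintegral_union_le _ _ _).trans ((add_le_add h1 h2).trans ?_)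
  rw [← ENNReal.ofReal_add (by positivity) (by positivity)]
  apply ENNReal.ofReal_le_ofReal
  rw [hl]
  apply le_of_eq
  field_simp

lemma aux_rad (k : ℕ) (hk : 1 ≤ k) (s lam γ δ : ℝ) (hs : 0 < s) (hγ : 0 < γ) (hδ : 0 < δ)
    (hl : lam = γ + δ) :
    ∫⁻ y : EuclideanSpace ℝ (Fin k),
        ENNReal.ofReal ((s ^ 2 + ‖y‖ ^ 2) ^ (-(lam / 2)) * ‖y‖ ^ (δ - k))
      ≤ ENNReal.ofReal ((k : ℝ) * (volume (Metric.ball (0 : EuclideanSpace ℝ (Fin k)) 1)).toReal)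
        * ENNReal.ofReal (s ^ (-γ) * (lam / (γ * δ))) := by
  have : Nonempty (Fin k) := ⟨⟨0, hk⟩⟩
  have hR := aux_rad1 s lam γ δ hs hγ hδ hl
  set f : ℝ → ℝ := fun ρ => (s ^ 2 + ρ ^ 2) ^ (-(lam / 2)) * ρ ^ (δ - k) with hf
  have heq : ∀ ρ ∈ Ioi (0 : ℝ), ρ ^ (k - 1) • f ρ
      = (s ^ 2 + ρ ^ 2) ^ (-(lam / 2)) * ρ ^ (δ - 1) := by
    intro ρ hρ
    have hρ0 : (0 : ℝ) < ρ := hρ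
    simp only [hf, smul_eq_mul]
    rw [← Real.rpow_natCast, mul_left_comm, ← Real.rpow_add hρ0]
    congr 2
    push_cast [Nat.cast_sub hk]
    ring
  have hnn : ∀ ρ ∈ Ioi (0 : ℝ), 0 ≤ (s ^ 2 + ρ ^ 2) ^ (-(lam / 2)) * ρ ^ (δ - 1) := by
    intro ρ hρ
    have hρ0 : (0 : ℝ) < ρ := hρ
    positivity
  have hae : 0 ≤ᵐ[volume.restrict (Ioi (0 : ℝ))]
      fun ρ : ℝ => (s ^ 2 + ρ ^ 2) ^ (-(lam / 2)) * ρ ^ (δ - 1) := by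
    filter_upwards [ae_restrict_mem measurableSet_Ioi] with ρ hρ
    exact hnn ρ hρ
  have hint1 : IntegrableOn (fun ρ : ℝ => (s ^ 2 + ρ ^ 2) ^ (-(lam / 2)) * ρ ^ (δ - 1))
      (Ioi 0) := by
    refine ⟨Measurable.aestronglyMeasurable (by fun_prop), ?_⟩
    rw [hasFiniteIntegral_iff_ofReal hae]
    exact hR.trans_lt ENNReal.ofReal_lt_top
  have hint2 : IntegrableOn (fun ρ : ℝ => ρ ^ (k - 1) • f ρ) (Ioi 0) :=
    hint1.congr_fun (fun ρ hρ => (heq ρ hρ).symm) measurableSet_Ioi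
  have hint3 : Integrable (fun y : EuclideanSpace ℝ (Fin k) => f ‖y‖) := by
    rw [integrable_fun_norm_addHaar]
    simpa using hint2
  change ∫⁻ y : EuclideanSpace ℝ (Fin k), ENNReal.ofReal (f ‖y‖) ≤ _
  rw [← ofReal_integral_eq_lintegral_ofReal hint3 (Filter.Eventually.of_forall fun y => by
    simp only [hf, Pi.zero_apply]; positivity), integral_fun_norm_addHaar]
  rw [← ofReal_integral_eq_lintegral_ofReal hint1 hae] at hR
  rw [finrank_euclideanSpace_fin, setIntegral_congr_fun measurableSet_Ioi heq, nsmul_eq_mul,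
    smul_eq_mul, ← mul_assoc, ENNReal.ofReal_mul (by positivity)]
  exact mul_le_mul_right hR _

lemma aux_const (lam γ δ q : ℝ) (hγ : 0 < γ) (hδ : 0 < δ) (hl : lam = γ + δ) (hq : 1 < q) :
    lam / (γ * δ) ≤ (lam * 2 ^ (2 * γ + 1) / γ * (1 / δ)) ^ q := by
  have hlam : 0 < lam := by linarith
  set a := lam / (γ * δ) with ha
  have ha0 : 0 < a := by positivity
  have h1 : lam * 2 ^ (2 * γ + 1) / γ * (1 / δ) = a * 2 ^ (2 * γ + 1) := by
    rw [ha]; field_simp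
  have h2 : 1 / γ ≤ a := by
    rw [ha, hl, div_le_div_iff₀ hγ (by positivity)]
    nlinarith
  have h3 : γ ≤ (2 : ℝ) ^ (2 * γ + 1) := by
    have := Real.add_one_le_exp (γ * Real.log 2 * 2)
    have hlog := Real.log_two_gt_d9
    calc γ ≤ γ * Real.log 2 * 2 + 1 := by nlinarith
      _ ≤ Real.exp (γ * Real.log 2 * 2) := this
      _ = (2 : ℝ) ^ (2 * γ) := by
        rw [Real.rpow_def_of_pos (by norm_num)]; congr 1; ring
      _ ≤ _ := Real.rpow_le_rpow_of_exponent_le (by norm_num) (by linarith)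
  have h4 : (1 : ℝ) ≤ 2 ^ (2 * γ + 1) := Real.one_le_rpow (by norm_num) (by linarith)
  have h5 : 1 ≤ a * 2 ^ (2 * γ + 1) := by
    calc (1 : ℝ) = 1 / γ * γ := by field_simp
      _ ≤ _ := mul_le_mul h2 h3 hγ.le ha0.le
  rw [h1]
  calc a ≤ a * 2 ^ (2 * γ + 1) := le_mul_of_one_le_right ha0.le h4
    _ = (a * 2 ^ (2 * γ + 1)) ^ (1 : ℝ) := (Real.rpow_one _).symm
    _ ≤ _ := Real.rpow_le_rpow_of_exponent_le h5 hq.le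

theorem stmt_5 (n k : ℕ) (hk : 1 ≤ k) (hkn : k < n) (p r lam β q γ : ℝ)
    (hp : 1 < p) (hr : 1 < r) (hlam : 0 < lam)
    (hβ1 : lam ≤ (n : ℝ) - k → β < k - k / r)
    (hβ2 : (n : ℝ) - k < lam → β < n - lam - k / r)
    (hq : q = r / (r - 1)) (hγ : γ = lam - k / q + β) (hγpos : 0 < γ)
    (h : EuclideanSpace ℝ (Fin (n - k)) → ℝ) (hh : Measurable h) (hpos : ∀ x, 0 ≤ h x) :
    ∫⁻ y : EuclideanSpace ℝ (Fin (n - k)) × EuclideanSpace ℝ (Fin k),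
        (∫⁻ x, ENNReal.ofReal
          (h x / ((dist x y.1 ^ 2 + ‖y.2‖ ^ 2) ^ (lam / 2) * ‖y.2‖ ^ β))) ^ q
      ≤ ENNReal.ofReal ((lam * 2 ^ (2 * γ + 1) / γ * (1 / (k / q - β))) ^ q *
            ((k : ℝ) * (volume (Metric.ball (0 : EuclideanSpace ℝ (Fin k)) 1)).toReal)) *
          ∫⁻ z : EuclideanSpace ℝ (Fin (n - k)),
            (∫⁻ x, ENNReal.ofReal (h x / dist z x ^ γ)) ^ q := by
  have hr1 : 0 < r - 1 := by linarith
  have hq1 : 1 < q := by rw [hq, lt_div_iff₀ hr1]; linarith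
  have hq0 : 0 < q := by linarith
  have hkq : (k : ℝ) / q = k - k / r := by
    rw [hq]; field_simp
  have : Nonempty (Fin k) := ⟨⟨0, hk⟩⟩
  have : Nonempty (Fin (n - k)) := ⟨⟨0, by omega⟩⟩
  obtain ⟨δ, hδ⟩ : ∃ δ, δ = (k : ℝ) / q - β := ⟨_, rfl⟩
  have hδ0 : 0 < δ := by
    rw [hδ, hkq]
    rcases le_or_gt lam ((n : ℝ) - k) with h1 | h1
    · linarith [hβ1 h1]
    · linarith [hβ2 h1]
  have hl : lam = γ + δ := by linarith
  rw [← hδ]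
  set S : ℝ := (k : ℝ) * (volume (Metric.ball (0 : EuclideanSpace ℝ (Fin k)) 1)).toReal with hS
  have hS0 : 0 ≤ S := by positivity
  have hC := aux_const lam γ δ q hγpos hδ0 hl hq1
  set C := (lam * 2 ^ (2 * γ + 1) / γ * (1 / δ)) ^ q
  have hexp : (k : ℝ) / q * (q - 1) = k - k / q := by field_simp
  refine (lintegral_prod_le _).trans ?_
  rw [← lintegral_const_mul' _ _ ENNReal.ofReal_ne_top]
  refine lintegral_mono fun y' => ?_
  have hIeq : ∫⁻ x, ENNReal.ofReal (h x / dist y' x ^ γ)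
      = ∫⁻ x, ENNReal.ofReal (h x) * ENNReal.ofReal (dist x y' ^ (-γ)) := by
    refine lintegral_congr fun x => ?_
    rw [← ENNReal.ofReal_mul (hpos x), dist_comm, Real.rpow_neg dist_nonneg, div_eq_mul_inv]
  set I := ∫⁻ x, ENNReal.ofReal (h x / dist y' x ^ γ) with hI
  have hne : ∀ᵐ x : EuclideanSpace ℝ (Fin (n - k)), 0 < dist x y' := by
    filter_upwards [compl_mem_ae_iff.mpr (measure_singleton y')] with x hx
    exact dist_pos.mpr hx
  have hstep : ∀ᵐ y : EuclideanSpace ℝ (Fin k),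
      (∫⁻ x, ENNReal.ofReal
          (h x / ((dist x y' ^ 2 + ‖y‖ ^ 2) ^ (lam / 2) * ‖y‖ ^ β))) ^ q
      ≤ I ^ (q - 1) * ∫⁻ x, ENNReal.ofReal (h x) * ENNReal.ofReal
          ((dist x y' ^ 2 + ‖y‖ ^ 2) ^ (-(lam / 2)) * ‖y‖ ^ (δ - k)) := by
    filter_upwards [compl_mem_ae_iff.mpr (measure_singleton (0 : EuclideanSpace ℝ (Fin k)))]
      with y hy
    have hy0 : 0 < ‖y‖ := norm_pos_iff.mpr hy
    set F := ∫⁻ x, ENNReal.ofReal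
          (h x / ((dist x y' ^ 2 + ‖y‖ ^ 2) ^ (lam / 2) * ‖y‖ ^ β)) with hF
    have hA : F ≤ I * ENNReal.ofReal (‖y‖ ^ (-((k : ℝ) / q))) := by
      rw [hIeq, ← lintegral_mul_const' _ _ ENNReal.ofReal_ne_top, hF]
      refine lintegral_mono_ae ?_
      filter_upwards [hne] with x hx
      set s := dist x y'
      rw [← ENNReal.ofReal_mul (hpos x), ← ENNReal.ofReal_mul (mul_nonneg (hpos x) (by positivity)),
        mul_assoc]
      apply ENNReal.ofReal_le_ofReal
      rw [div_eq_mul_inv]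
      apply mul_le_mul_of_nonneg_left _ (hpos x)
      rw [mul_inv, ← Real.rpow_neg (by positivity), ← Real.rpow_neg hy0.le,
        show -((k : ℝ) / q) = -δ + -β by linarith, Real.rpow_add hy0, ← mul_assoc]
      apply mul_le_mul_of_nonneg_right _ (by positivity)
      rw [show -(lam / 2) = -γ / 2 + -δ / 2 by rw [hl]; ring, Real.rpow_add (by positivity)]
      have hsq : ∀ t e : ℝ, 0 < t → t ^ e = (t ^ 2) ^ (e / 2) := by
        intro t e ht
        rw [← Real.rpow_natCast t 2, ← Real.rpow_mul ht.le]
        congr 1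
        push_cast
        ring
      rw [hsq s _ hx, hsq ‖y‖ _ hy0]
      apply mul_le_mul _ _ (by positivity) (by positivity)
      · exact Real.rpow_le_rpow_of_nonpos (by positivity) (by nlinarith [sq_nonneg ‖y‖])
            (by linarith)
      · exact Real.rpow_le_rpow_of_nonpos (by positivity) (by nlinarith [sq_nonneg s])
            (by linarith)
    have hB : ENNReal.ofReal (‖y‖ ^ (-((k : ℝ) / q))) ^ (q - 1) * F
        = ∫⁻ x, ENNReal.ofReal (h x) * ENNReal.ofReal
          ((dist x y' ^ 2 + ‖y‖ ^ 2) ^ (-(lam / 2)) * ‖y‖ ^ (δ - k)) := by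
      rw [ENNReal.ofReal_rpow_of_pos (by positivity), ← Real.rpow_mul hy0.le, hF,
        ← lintegral_const_mul' _ _ ENNReal.ofReal_ne_top]
      refine lintegral_congr fun x => ?_
      rw [← ENNReal.ofReal_mul (hpos x), ← ENNReal.ofReal_mul (by positivity)]
      congr 1
      rw [div_eq_mul_inv (h x), mul_inv, ← Real.rpow_neg (by positivity), ← Real.rpow_neg hy0.le,
        show δ - (k : ℝ) = -((k : ℝ) / q) * (q - 1) + -β by linarith, Real.rpow_add hy0]
      ring
    calc F ^ q = F ^ (q - 1) * F := by
          conv_rhs => rw [← ENNReal.rpow_one F, ← ENNReal.rpow_mul, one_mul]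
          rw [← ENNReal.rpow_add_of_nonneg _ _ (by linarith) (by norm_num)]
          congr 1
          ring
      _ ≤ (I * ENNReal.ofReal (‖y‖ ^ (-((k : ℝ) / q)))) ^ (q - 1) * F :=
          mul_le_mul_left (ENNReal.rpow_le_rpow hA (by linarith)) _
      _ = _ := by
          rw [ENNReal.mul_rpow_of_nonneg _ _ (by linarith), mul_assoc, hB]
  have hIq : I ^ (q - 1) * I = I ^ q := by
    conv_lhs => rw [← ENNReal.rpow_one I, ← ENNReal.rpow_mul, one_mul]
    rw [← ENNReal.rpow_add_of_nonneg _ _ (by linarith) (by norm_num)]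
    congr 1
    ring
  have hmeas : Measurable (Function.uncurry fun (y : EuclideanSpace ℝ (Fin k))
      (x : EuclideanSpace ℝ (Fin (n - k))) => ENNReal.ofReal (h x) * ENNReal.ofReal
          ((dist x y' ^ 2 + ‖y‖ ^ 2) ^ (-(lam / 2)) * ‖y‖ ^ (δ - k))) := by
    unfold Function.uncurry
    fun_prop
  calc _ ≤ ∫⁻ y : EuclideanSpace ℝ (Fin k), I ^ (q - 1) * ∫⁻ x, ENNReal.ofReal (h x) *
          ENNReal.ofReal ((dist x y' ^ 2 + ‖y‖ ^ 2) ^ (-(lam / 2)) * ‖y‖ ^ (δ - k)) :=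
        lintegral_mono_ae hstep
    _ = I ^ (q - 1) * ∫⁻ x, ∫⁻ y : EuclideanSpace ℝ (Fin k), ENNReal.ofReal (h x) *
          ENNReal.ofReal ((dist x y' ^ 2 + ‖y‖ ^ 2) ^ (-(lam / 2)) * ‖y‖ ^ (δ - k)) := by
        rw [lintegral_const_mul _ (Measurable.lintegral_prod_right hmeas),
          lintegral_lintegral_swap hmeas.aemeasurable]
    _ ≤ I ^ (q - 1) * ∫⁻ x, ENNReal.ofReal (S * (lam / (γ * δ))) *
          (ENNReal.ofReal (h x) * ENNReal.ofReal (dist x y' ^ (-γ))) := by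
        refine mul_le_mul_right (lintegral_mono_ae ?_) _
        filter_upwards [hne] with x hx
        rw [lintegral_const_mul' _ _ ENNReal.ofReal_ne_top, mul_left_comm]
        refine mul_le_mul_right ((aux_rad k hk _ lam γ δ hx hγpos hδ0 hl).trans_eq ?_) _
        rw [← ENNReal.ofReal_mul hS0, ← ENNReal.ofReal_mul (by positivity)]
        congr 1
        ring
    _ = ENNReal.ofReal (S * (lam / (γ * δ))) * I ^ q := by
        rw [lintegral_const_mul' _ _ ENNReal.ofReal_ne_top, ← hIeq, mul_left_comm, hIq]
    _ ≤ _ := by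
        refine mul_le_mul_left (ENNReal.ofReal_le_ofReal ?_) _
        rw [mul_comm]
        exact mul_le_mul_of_nonneg_right hC hS0
end

section
/- Let $n > k \geq 1$, $\lambda > 0$, $\beta \in \mathbb{R}$, and $q \geq 1$ with $0 < \lambda - k/q + \beta < n - k$. Then there exists a constant $C > 0$ depending only on $n, k, \lambda, \beta, q$ such that for any non-negative measurable function $h$ on $\mathbb{R}^{n-k}$, $\int_{\mathbb{R}^{n-k}} \Big( \int_{\mathbb{R}^{n-k}} \frac{h(x)}{|z - x|^{\lambda - k/q + \beta}} dx \Big)^q dz \leq C \int_{\mathbb{R}^n} \Big( \int_{\mathbb{R}^{n-k}} \frac{h(x)}{|x - y|^{\lambda} |y''|^{\beta}} dx \Big)^q dy$. -/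
open MeasureTheory Set
open scoped ENNReal

lemma w_bern (q : ℝ) (hq : 1 ≤ q) (x d : ℝ≥0∞) :
    (x + d) ^ q ≤ x ^ q + ENNReal.ofReal q * (d * (x + d) ^ (q - 1)) := by
  have hq0 : 0 < q := by linarith
  have hqt : ENNReal.ofReal q ≠ 0 := by simpa using hq0
  rcases eq_or_ne x ⊤ with rfl | hx
  · simp [hq0]
  rcases eq_or_ne d ⊤ with rfl | hd
  · rcases eq_or_lt_of_le hq with h | h
    · subst h; simp
    · have : 0 < q - 1 := by linarith
      simp [this, ENNReal.mul_top hqt]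
  lift x to NNReal using hx
  lift d to NNReal using hd
  rcases eq_or_ne (x + d) 0 with h0 | h0
  · have hx : x = 0 := by
      have := (add_eq_zero.1 h0).1; exact this
    have hd : d = 0 := by
      have := (add_eq_zero.1 h0).2; exact this
    subst hx; subst hd
    simp [hq0]
  have hy : (0:ℝ) < x + d := by
    have : 0 < x + d := pos_iff_ne_zero.2 h0
    exact_mod_cast this
  have key : ((x:ℝ) + d) ^ q ≤ (x:ℝ) ^ q + q * (d * ((x:ℝ) + d) ^ (q - 1)) := by
    have hb := one_add_mul_self_le_rpow_one_add (s := (x:ℝ) / (x + d) - 1)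
      (by have : (0:ℝ) ≤ (x:ℝ)/(x+d) := by positivity
          linarith) hq
    rw [add_sub_cancel, Real.div_rpow (by positivity) hy.le] at hb
    have hY : (0:ℝ) < ((x:ℝ) + d) ^ q := Real.rpow_pos_of_pos hy q
    rw [le_div_iff₀ hY] at hb
    rw [Real.rpow_sub_one hy.ne']
    have : q * ((d:ℝ) * (((x:ℝ) + d) ^ q / (x + d))) = - (q * ((x:ℝ)/(x+d) - 1)) * ((x:ℝ) + d) ^ q := by
      field_simp; ring
    rw [this]; linarith
  have e1 : ∀ (y : NNReal) , (y : ℝ≥0∞) = ENNReal.ofReal (y:ℝ) := fun y => (ENNReal.ofReal_coe_nnreal).symm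
  rw [e1 x, e1 d, ← ENNReal.ofReal_add (by positivity) (by positivity),
    ENNReal.ofReal_rpow_of_pos hy, ENNReal.ofReal_rpow_of_nonneg (by positivity) hq0.le,
    ENNReal.ofReal_rpow_of_pos hy, ← ENNReal.ofReal_mul (by positivity),
    ← ENNReal.ofReal_mul (by positivity), ← ENNReal.ofReal_add (by positivity) (by positivity)]
  exact ENNReal.ofReal_le_ofReal key

lemma w_tele (q : ℝ) (hq : 1 ≤ q) (a : ℤ → ℝ≥0∞) (s : Finset ℤ) :
    (∑ j ∈ s, a j) ^ q ≤
      ENNReal.ofReal q * ∑ j ∈ s, a j * (∑' l : ℕ, a (j + l)) ^ (q - 1) := by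
  induction s using Finset.induction_on_min with
  | empty => simp [show 0 < q by linarith]
  | insert j s hj ih =>
    have hjs : j ∉ s := fun h => lt_irrefl _ (hj j h)
    rw [Finset.sum_insert hjs, Finset.sum_insert hjs, mul_add, add_comm (a j)]
    refine (w_bern q hq _ _).trans ?_
    rw [add_comm]
    gcongr ENNReal.ofReal q * (a j * ?_) + ?_
    refine ENNReal.rpow_le_rpow ?_ (by linarith)
    rw [add_comm, ← Finset.sum_insert hjs]
    have hinj : Set.InjOn (fun i : ℤ => (i - j).toNat) (insert j s : Finset ℤ) := by
      intro x hx y hy hxy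
      have h1 : j ≤ x := by
        rcases Finset.mem_insert.1 (Finset.mem_coe.1 hx) with h | h
        · exact h.ge
        · exact (hj x h).le
      have h2 : j ≤ y := by
        rcases Finset.mem_insert.1 (Finset.mem_coe.1 hy) with h | h
        · exact h.ge
        · exact (hj y h).le
      simp only at hxy
      omega
    calc ∑ i ∈ insert j s, a i
        = ∑ l ∈ (insert j s).image (fun i : ℤ => (i - j).toNat), a (j + l) := by
          rw [Finset.sum_image hinj]
          refine Finset.sum_congr rfl fun x hx => ?_
          have h1 : j ≤ x := by
            rcases Finset.mem_insert.1 hx with h | h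
            · exact h.ge
            · exact (hj x h).le
          congr 1; omega
      _ ≤ _ := ENNReal.sum_le_tsum _

lemma w_geom (θ : ℝ) (hθ : 0 < θ) : ∑' l : ℕ, (2:ℝ≥0∞) ^ (-(θ * l)) ≠ ⊤ := by
  have : ∀ l : ℕ, (2:ℝ≥0∞) ^ (-(θ * l)) = ((2:ℝ≥0∞) ^ (-θ)) ^ l := by
    intro l
    rw [← ENNReal.rpow_natCast, ← ENNReal.rpow_mul]; congr 1; ring
  simp_rw [this]
  rw [ENNReal.tsum_geometric]
  have h : (2:ℝ≥0∞) ^ (-θ) < 1 := ENNReal.rpow_lt_one_of_one_lt_of_neg (by norm_num) (by linarith)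
  exact ENNReal.inv_ne_top.2 (tsub_pos_of_lt h).ne'

lemma two_mul_rpow (x y : ℝ) : (2:ℝ≥0∞) ^ x * 2 ^ y = 2 ^ (x + y) :=
  (ENNReal.rpow_add x y (by norm_num) (by norm_num)).symm

lemma w_holder (p θ : ℝ) (hp : 0 ≤ p) (hθ : 0 < θ) : ∃ C : ℝ≥0∞, C ≠ ⊤ ∧ ∀ b : ℕ → ℝ≥0∞,
    (∑' l, b l) ^ p ≤ C * ∑' l : ℕ, (2:ℝ≥0∞) ^ (θ * l) * b l ^ p := by
  rcases eq_or_lt_of_le hp with rfl | hp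
  · refine ⟨1, by simp, fun b => ?_⟩
    rw [one_mul]
    refine le_trans ?_ (ENNReal.le_tsum 0)
    simp
  · refine ⟨(∑' l : ℕ, (2:ℝ≥0∞) ^ (-((θ / p) * l))) ^ p,
      ENNReal.rpow_ne_top_of_nonneg hp.le (w_geom _ (by positivity)), fun b => ?_⟩
    set T := ∑' l : ℕ, (2:ℝ≥0∞) ^ (θ * l) * b l ^ p with hT
    have h1 : ∀ l, b l ≤ (2:ℝ≥0∞) ^ (-((θ / p) * l)) * T ^ (1 / p) := by
      intro l
      have : (2:ℝ≥0∞) ^ (θ * l) * b l ^ p ≤ T := ENNReal.le_tsum l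
      calc b l = (2:ℝ≥0∞) ^ (-((θ / p) * l)) * ((2:ℝ≥0∞) ^ (θ * l) * b l ^ p) ^ (1 / p) := by
            rw [ENNReal.mul_rpow_of_nonneg _ _ (by positivity), ← ENNReal.rpow_mul,
              ← ENNReal.rpow_mul, ← mul_assoc, two_mul_rpow, mul_one_div_cancel hp.ne',
              ENNReal.rpow_one]
            have : -(θ / p * l) + θ * l * (1 / p) = 0 := by ring
            rw [this]; simp
        _ ≤ _ := by gcongr
    calc (∑' l, b l) ^ p ≤ (∑' l : ℕ, (2:ℝ≥0∞) ^ (-((θ / p) * l)) * T ^ (1 / p)) ^ p := by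
          gcongr with l; exact h1 l
      _ = _ := by
          rw [ENNReal.tsum_mul_right, ENNReal.mul_rpow_of_nonneg _ _ hp.le, ← ENNReal.rpow_mul,
            one_div_mul_cancel hp.ne', ENNReal.rpow_one]

lemma w_point (q θ : ℝ) (hq : 1 ≤ q) (hθ : 0 < θ) : ∃ C : ℝ≥0∞, C ≠ ⊤ ∧ ∀ a : ℤ → ℝ≥0∞,
    (∑' j, a j) ^ q ≤ C * ∑' l : ℕ, ∑' j : ℤ,
      (2:ℝ≥0∞) ^ (θ * l) * (a j * a (j + l) ^ (q - 1)) := by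
  obtain ⟨C, hC, h⟩ := w_holder (q - 1) θ (by linarith) hθ
  refine ⟨ENNReal.ofReal q * C, ENNReal.mul_ne_top (by simp) hC, fun a => ?_⟩
  have h1 : (∑' j, a j) ^ q ≤
      ENNReal.ofReal q * ∑' j, a j * (∑' l : ℕ, a (j + l)) ^ (q - 1) := by
    have ht : Filter.Tendsto (fun s : Finset ℤ => (∑ j ∈ s, a j) ^ q) Filter.atTop
        (nhds ((∑' j, a j) ^ q)) :=
      (ENNReal.continuous_rpow_const.tendsto _).comp ENNReal.summable.hasSum
    refine le_of_tendsto' ht fun s => (w_tele q hq a s).trans ?_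
    gcongr
    exact ENNReal.sum_le_tsum _
  refine h1.trans ?_
  rw [mul_assoc]
  refine mul_le_mul' le_rfl ?_
  rw [ENNReal.tsum_comm (α := ℕ), ← ENNReal.tsum_mul_left (a := C)]
  refine ENNReal.tsum_le_tsum fun j => ?_
  calc a j * (∑' l : ℕ, a (j + l)) ^ (q - 1)
      ≤ a j * (C * ∑' l : ℕ, (2:ℝ≥0∞) ^ (θ * l) * a (j + l) ^ (q - 1)) := by
        gcongr; exact h _
    _ = _ := by
        rw [mul_left_comm, ← ENNReal.tsum_mul_left]
        congr 1
        refine tsum_congr fun l => ?_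
        ring

lemma two_ne_top (x : ℝ) : (2:ℝ≥0∞) ^ x ≠ ⊤ :=
  ENNReal.rpow_ne_top_of_ne_zero (by norm_num) (by norm_num)

set_option linter.unusedSectionVars false

section Wolff
open Metric
variable {E : Type*} [NormedAddCommGroup E] [NormedSpace ℝ E] [FiniteDimensional ℝ E]
  [MeasurableSpace E] [BorelSpace E] [SecondCountableTopology E]

lemma ball_meas (r : ℝ) : MeasurableSet {p : E × E | p.2 ∈ ball p.1 r} := by
  have : {p : E × E | p.2 ∈ ball p.1 r} = {p | dist p.2 p.1 < r} := rfl
  rw [this]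
  exact measurableSet_lt (measurable_snd.dist measurable_fst) measurable_const

lemma ball_ind_meas (r : ℝ) (F : E → E → ℝ≥0∞) (hF : Measurable (Function.uncurry F)) :
    Measurable (Function.uncurry fun z w => (ball z r).indicator (F z) w) := by
  have : (Function.uncurry fun z w => (ball z r).indicator (F z) w)
      = {p : E × E | p.2 ∈ ball p.1 r}.indicator (Function.uncurry F) := by
    ext ⟨z, w⟩
    by_cases h : w ∈ ball z r
    · rw [Set.indicator_of_mem (show (z, w) ∈ {p : E × E | p.2 ∈ ball p.1 r} from h)]
      simp [h]
    · rw [Set.indicator_of_notMem (show (z, w) ∉ {p : E × E | p.2 ∈ ball p.1 r} from h)]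
      simp [h]
  rw [this]
  exact hF.indicator (ball_meas r)

lemma A_meas (μ : Measure E) [μ.IsAddHaarMeasure] (H : E → ℝ≥0∞) (hH : Measurable H) (r : ℝ) :
    Measurable fun z => ∫⁻ x in ball z r, H x ∂μ := by
  simp_rw [← lintegral_indicator measurableSet_ball]
  exact (ball_ind_meas r (fun _ w => H w) (hH.comp measurable_snd)).lintegral_prod_right'

lemma ball_swap (μ : Measure E) [μ.IsAddHaarMeasure] (r : ℝ) (F : E → E → ℝ≥0∞)
    (hF : Measurable (Function.uncurry F)) :
    ∫⁻ z, ∫⁻ w in ball z r, F z w ∂μ ∂μ = ∫⁻ w, ∫⁻ z in ball w r, F z w ∂μ ∂μ := by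
  simp_rw [← lintegral_indicator measurableSet_ball]
  rw [lintegral_lintegral_swap (ball_ind_meas r F hF).aemeasurable]
  refine lintegral_congr fun w => lintegral_congr fun z => ?_
  by_cases h : w ∈ ball z r
  · simp [h, mem_ball_comm.1 h]
  · have h' : z ∉ ball w r := fun h' => h (mem_ball_comm.1 h')
    simp [h, h']

lemma inner_bd (μ : Measure E) [μ.IsAddHaarMeasure] (H : E → ℝ≥0∞) (hH : Measurable H)
    (r R : ℝ) (hrR : r ≤ R) (w : E) :
    ∫⁻ z in ball w R, (∫⁻ x in ball z r, H x ∂μ) ∂μ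
      ≤ μ (ball 0 r) * ∫⁻ x in ball w (2 * R), H x ∂μ := by
  have h1 : Measurable (Function.uncurry fun z x => (ball w R).indicator (fun _ : E => H x) z) := by
    have : (Function.uncurry fun z x => (ball w R).indicator (fun _ : E => H x) z) =
      (Prod.fst ⁻¹' ball w R).indicator (fun p : E × E => H p.2) := by
      ext ⟨z, x⟩; simp [Set.indicator]
    rw [this]
    exact (hH.comp measurable_snd).indicator (measurable_fst measurableSet_ball)
  calc ∫⁻ z in ball w R, (∫⁻ x in ball z r, H x ∂μ) ∂μ
      = ∫⁻ z, ∫⁻ x in ball z r, (ball w R).indicator (fun _ : E => H x) z ∂μ ∂μ := by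
        rw [← lintegral_indicator measurableSet_ball]
        refine lintegral_congr fun z => ?_
        by_cases hz : z ∈ ball w R <;> simp [hz]
    _ = ∫⁻ x, ∫⁻ z in ball x r, (ball w R).indicator (fun _ : E => H x) z ∂μ ∂μ :=
        ball_swap μ r _ h1
    _ ≤ ∫⁻ x, (ball w (2 * R)).indicator (fun x => μ (ball 0 r) * H x) x ∂μ := by
        refine lintegral_mono fun x => ?_
        by_cases hx : x ∈ ball w (2 * R)
        · simp only [hx, Set.indicator_of_mem]
          calc ∫⁻ z in ball x r, (ball w R).indicator (fun _ : E => H x) z ∂μ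
              ≤ ∫⁻ z in ball x r, H x ∂μ :=
                lintegral_mono fun z => Set.indicator_le_self (ball w R) (fun _ : E => H x) z
            _ = _ := by
              rw [lintegral_const, Measure.restrict_apply_univ, Measure.addHaar_ball_center,
                mul_comm]
        · simp only [hx, Set.indicator_of_notMem, not_false_eq_true, nonpos_iff_eq_zero]
          rw [← lintegral_indicator measurableSet_ball]
          rw [lintegral_eq_zero_of_ae_eq_zero]
          refine Filter.Eventually.of_forall fun z => ?_
          by_cases h1 : z ∈ ball x r
          · have h2 : z ∉ ball w R := by
              intro h2
              apply hx
              rw [mem_ball] at *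
              have := dist_triangle x z w
              rw [dist_comm x z] at this
              linarith
            simp [h2]
          · simp [h1]
    _ = _ := by
        rw [lintegral_indicator measurableSet_ball, lintegral_const_mul _ hH]

lemma key_two (μ : Measure E) [μ.IsAddHaarMeasure] (H : E → ℝ≥0∞) (hH : Measurable H)
    (r R p : ℝ) (hrR : r ≤ R) (hp : 0 ≤ p) :
    μ (ball 0 R) * ∫⁻ z, (∫⁻ x in ball z r, H x ∂μ) * (∫⁻ x in ball z R, H x ∂μ) ^ p ∂μ
      ≤ μ (ball 0 r) * ∫⁻ w, (∫⁻ x in ball w (2 * R), H x ∂μ) ^ (p + 1) ∂μ := by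
  have mr := A_meas μ H hH r
  have mR := A_meas μ H hH R
  have m2 := A_meas μ H hH (2 * R)
  calc _ = ∫⁻ z, ∫⁻ w in ball z R,
        (∫⁻ x in ball z r, H x ∂μ) * (∫⁻ x in ball z R, H x ∂μ) ^ p ∂μ ∂μ := by
        rw [← lintegral_const_mul' _ _ measure_ball_lt_top.ne]
        refine lintegral_congr fun z => ?_
        rw [lintegral_const, Measure.restrict_apply_univ, Measure.addHaar_ball_center μ z R, mul_comm]
    _ ≤ ∫⁻ z, ∫⁻ w in ball z R,
        (∫⁻ x in ball z r, H x ∂μ) * (∫⁻ x in ball w (2 * R), H x ∂μ) ^ p ∂μ ∂μ := by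
        refine lintegral_mono fun z => setLIntegral_mono' measurableSet_ball fun w hw => ?_
        gcongr
        refine ball_subset_ball' ?_
        rw [mem_ball, dist_comm] at hw
        linarith
    _ = ∫⁻ w, ∫⁻ z in ball w R,
        (∫⁻ x in ball z r, H x ∂μ) * (∫⁻ x in ball w (2 * R), H x ∂μ) ^ p ∂μ ∂μ := by
        refine ball_swap μ R (fun z w =>
          (∫⁻ x in ball z r, H x ∂μ) * (∫⁻ x in ball w (2 * R), H x ∂μ) ^ p) ?_
        exact (mr.comp measurable_fst).mul ((m2.comp measurable_snd).pow_const p)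
    _ ≤ ∫⁻ w, μ (ball 0 r) * (∫⁻ x in ball w (2 * R), H x ∂μ) ^ (p + 1) ∂μ := by
        refine lintegral_mono fun w => ?_
        simp only
        rw [lintegral_mul_const _ mr, add_comm p 1, ENNReal.rpow_add_of_nonneg _ _ (by norm_num) hp,
          ENNReal.rpow_one, ← mul_assoc]
        gcongr
        exact inner_bd μ H hH r R hrR w
    _ = _ := by rw [lintegral_const_mul _ (m2.pow_const _)]

lemma of_two (x : ℝ) : ENNReal.ofReal ((2:ℝ) ^ x) = (2:ℝ≥0∞) ^ x := by
  rw [← ENNReal.ofReal_rpow_of_pos (by norm_num)]; simp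

lemma ball_two (μ : Measure E) [μ.IsAddHaarMeasure] (x : ℝ) :
    μ (ball (0:E) ((2:ℝ) ^ x)) = (2:ℝ≥0∞) ^ (x * Module.finrank ℝ E) * μ (ball 0 1) := by
  rw [Measure.addHaar_ball_of_pos _ _ (by positivity), ← of_two, Real.rpow_mul (by norm_num),
    Real.rpow_natCast]

lemma key_three (μ : Measure E) [μ.IsAddHaarMeasure] (H : E → ℝ≥0∞) (hH : Measurable H)
    (α q : ℝ) (hq : 1 ≤ q) (j : ℤ) (l : ℕ) :
    ∫⁻ z, ((2:ℝ≥0∞) ^ (-(j * α)) * ∫⁻ x in ball z ((2:ℝ) ^ (j:ℝ)), H x ∂μ) *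
      ((2:ℝ≥0∞) ^ (-(((j + l : ℤ) : ℝ) * α)) *
        ∫⁻ x in ball z ((2:ℝ) ^ ((j + l : ℤ):ℝ)), H x ∂μ) ^ (q - 1) ∂μ
    ≤ (2:ℝ≥0∞) ^ (α * q) * (2:ℝ≥0∞) ^ (-((Module.finrank ℝ E - α) * l)) *
      ∫⁻ z, ((2:ℝ≥0∞) ^ (-(((j + l + 1 : ℤ) : ℝ) * α)) *
        ∫⁻ x in ball z ((2:ℝ) ^ ((j + l + 1 : ℤ):ℝ)), H x ∂μ) ^ q ∂μ := by
  have hq1 : 0 ≤ q - 1 := by linarith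
  have k := key_two μ H hH ((2:ℝ) ^ (j:ℝ)) ((2:ℝ) ^ ((j + l : ℤ):ℝ)) (q - 1)
    (Real.rpow_le_rpow_of_exponent_le (by norm_num) (by push_cast; linarith [Nat.cast_nonneg (α := ℝ) l])) hq1
  have e2 : 2 * (2:ℝ) ^ ((j + l : ℤ):ℝ) = (2:ℝ) ^ ((j + l + 1 : ℤ):ℝ) := by
    push_cast
    rw [Real.rpow_add_one (by norm_num), mul_comm]
  rw [e2, ball_two, ball_two, sub_add_cancel] at k
  simp_rw [ENNReal.mul_rpow_of_nonneg _ _ hq1, ENNReal.mul_rpow_of_nonneg _ _ (by linarith : 0 ≤ q),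
    ← ENNReal.rpow_mul, mul_mul_mul_comm ((2:ℝ≥0∞) ^ (-(j * α))), two_mul_rpow]
  have mr := A_meas μ H hH ((2:ℝ) ^ (j:ℝ))
  have mR := A_meas μ H hH ((2:ℝ) ^ ((j + l : ℤ):ℝ))
  have m2 := A_meas μ H hH ((2:ℝ) ^ ((j + l + 1 : ℤ):ℝ))
  rw [lintegral_const_mul' _ _ (two_ne_top _), lintegral_const_mul _ (m2.pow_const _)]
  set I := ∫⁻ z, (∫⁻ x in ball z ((2:ℝ) ^ (j:ℝ)), H x ∂μ) *
      (∫⁻ x in ball z ((2:ℝ) ^ ((j + l : ℤ):ℝ)), H x ∂μ) ^ (q - 1) ∂μ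
  set J := ∫⁻ z, (∫⁻ x in ball z ((2:ℝ) ^ ((j + l + 1 : ℤ):ℝ)), H x ∂μ) ^ q ∂μ
  have hV0 : μ (ball (0:E) 1) ≠ 0 := (measure_ball_pos μ 0 one_pos).ne'
  have hV1 : μ (ball (0:E) 1) ≠ ⊤ := measure_ball_lt_top.ne
  set V := μ (ball (0:E) 1)
  set d : ℝ := (Module.finrank ℝ E : ℝ)
  have k2 : (2:ℝ≥0∞) ^ (((j + l : ℤ):ℝ) * d) * I ≤ (2:ℝ≥0∞) ^ ((j:ℝ) * d) * J := by
    rw [← ENNReal.mul_le_mul_iff_right hV0 hV1]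
    calc _ = _ := by ring
      _ ≤ _ := k
      _ = _ := by ring
  calc _ = (2:ℝ≥0∞) ^ (-(j * α) + -(((j + l : ℤ):ℝ) * α) * (q - 1) - ((j + l : ℤ):ℝ) * d) *
        ((2:ℝ≥0∞) ^ (((j + l : ℤ):ℝ) * d) * I) := by
        rw [← mul_assoc, two_mul_rpow, sub_add_cancel]
    _ ≤ (2:ℝ≥0∞) ^ (-(j * α) + -(((j + l : ℤ):ℝ) * α) * (q - 1) - ((j + l : ℤ):ℝ) * d) *
        ((2:ℝ≥0∞) ^ ((j:ℝ) * d) * J) := by gcongr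
    _ = _ := by
        rw [← mul_assoc, ← mul_assoc, two_mul_rpow, two_mul_rpow]
        congr 2
        push_cast
        ring

lemma wolff (μ : Measure E) [μ.IsAddHaarMeasure] (α q : ℝ) (hq : 1 ≤ q)
    (hα : α < Module.finrank ℝ E) : ∃ C : ℝ≥0∞, C ≠ ⊤ ∧ ∀ H : E → ℝ≥0∞, Measurable H →
    ∫⁻ z, (∑' j : ℤ, (2:ℝ≥0∞) ^ (-(j * α)) * ∫⁻ x in ball z ((2:ℝ) ^ (j:ℝ)), H x ∂μ) ^ q ∂μ
    ≤ C * ∑' j : ℤ, ∫⁻ z,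
      ((2:ℝ≥0∞) ^ (-(j * α)) * ∫⁻ x in ball z ((2:ℝ) ^ (j:ℝ)), H x ∂μ) ^ q ∂μ := by
  set d : ℝ := (Module.finrank ℝ E : ℝ) with hd
  set θ := (d - α) / 2 with hθd
  have hθ : 0 < θ := by rw [hθd]; linarith
  obtain ⟨C, hC, h⟩ := w_point q θ hq hθ
  refine ⟨C * ((2:ℝ≥0∞) ^ (α * q) * ∑' l : ℕ, (2:ℝ≥0∞) ^ (-(θ * l))), ENNReal.mul_ne_top hC
    (ENNReal.mul_ne_top (ENNReal.rpow_ne_top_of_ne_zero (by norm_num) (by norm_num))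
      (w_geom θ hθ)), fun H hH => ?_⟩
  have hm : ∀ j : ℤ, Measurable fun z =>
      (2:ℝ≥0∞) ^ (-(j * α)) * ∫⁻ x in ball z ((2:ℝ) ^ (j:ℝ)), H x ∂μ :=
    fun j => (A_meas μ H hH _).const_mul _
  have k3 := key_three μ H hH α q hq
  set a : ℤ → E → ℝ≥0∞ := fun j z =>
    (2:ℝ≥0∞) ^ (-(j * α)) * ∫⁻ x in ball z ((2:ℝ) ^ (j:ℝ)), H x ∂μ with ha
  change ∫⁻ z, (∑' j, a j z) ^ q ∂μ ≤ _ * ∑' j, ∫⁻ z, a j z ^ q ∂μ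
  have k3' : ∀ (j : ℤ) (l : ℕ), ∫⁻ z, a j z * a (j + l) z ^ (q - 1) ∂μ ≤
    (2:ℝ≥0∞) ^ (α * q) * (2:ℝ≥0∞) ^ (-((d - α) * l)) * ∫⁻ z, a (j + l + 1) z ^ q ∂μ := k3
  have hm' : ∀ j : ℤ, Measurable (a j) := hm
  have m1 : ∀ (l : ℕ) (j : ℤ), Measurable fun z =>
      (2:ℝ≥0∞) ^ (θ * l) * (a j z * a (j + l) z ^ (q - 1)) :=
    fun l j => ((hm' j).mul ((hm' _).pow_const _)).const_mul _
  calc ∫⁻ z, (∑' j, a j z) ^ q ∂μ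
      ≤ ∫⁻ z, C * ∑' l : ℕ, ∑' j : ℤ,
        (2:ℝ≥0∞) ^ (θ * l) * (a j z * a (j + l) z ^ (q - 1)) ∂μ :=
        lintegral_mono fun z => h fun j => a j z
    _ = C * ∑' l : ℕ, ∑' j : ℤ,
        (2:ℝ≥0∞) ^ (θ * l) * ∫⁻ z, (a j z * a (j + l) z ^ (q - 1)) ∂μ := by
        rw [lintegral_const_mul' _ _ hC, lintegral_tsum
          (fun l => (Measurable.tsum (fun j => m1 l j)).aemeasurable)]
        congr 1
        refine tsum_congr fun l => ?_
        rw [lintegral_tsum (fun j => (m1 l j).aemeasurable)]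
        refine tsum_congr fun j => ?_
        rw [lintegral_const_mul' _ _ (two_ne_top _)]
    _ ≤ C * ∑' l : ℕ, ∑' j : ℤ, (2:ℝ≥0∞) ^ (α * q) * (2:ℝ≥0∞) ^ (-(θ * l)) *
          ∫⁻ z, a (j + l + 1) z ^ q ∂μ := by
        refine mul_le_mul' le_rfl (ENNReal.tsum_le_tsum fun l => ENNReal.tsum_le_tsum fun j => ?_)
        refine (mul_le_mul' le_rfl (k3' j l)).trans (le_of_eq ?_)
        rw [← mul_assoc, ← mul_assoc, two_mul_rpow, two_mul_rpow, two_mul_rpow]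
        congr 2
        rw [hθd]; ring
    _ = C * ∑' l : ℕ, (2:ℝ≥0∞) ^ (α * q) * (2:ℝ≥0∞) ^ (-(θ * l)) *
          ∑' j : ℤ, ∫⁻ z, a j z ^ q ∂μ := by
        congr 1
        refine tsum_congr fun l => ?_
        rw [ENNReal.tsum_mul_left]
        congr 1
        have := (Equiv.addRight ((l:ℤ) + 1)).tsum_eq (fun j => ∫⁻ z, a j z ^ q ∂μ)
        rw [← this]
        refine tsum_congr fun j => ?_
        simp only [Equiv.coe_addRight, add_assoc]
    _ = _ := by
        rw [ENNReal.tsum_mul_right, ENNReal.tsum_mul_left]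
        simp only [mul_assoc]

lemma upper_pt (h : E → ℝ) (h0 : ∀ x, 0 ≤ h x) (α : ℝ) (hα : 0 < α) (z x : E) :
    ENNReal.ofReal (h x / dist z x ^ α) ≤ (2:ℝ≥0∞) ^ α * ∑' j : ℤ, (2:ℝ≥0∞) ^ (-(j * α)) *
      (ball z ((2:ℝ) ^ (j:ℝ))).indicator (fun x => ENNReal.ofReal (h x)) x := by
  rcases eq_or_lt_of_le (dist_nonneg (x := z) (y := x)) with hd | hd
  · rw [← hd, Real.zero_rpow hα.ne']; simp
  obtain ⟨i, hi1, hi2⟩ := exists_mem_Ico_zpow hd (one_lt_two (α := ℝ))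
  refine le_trans ?_ (mul_le_mul' le_rfl (ENNReal.le_tsum (i + 1)))
  rw [← Real.rpow_intCast] at hi1 hi2
  rw [Set.indicator_of_mem (by rw [mem_ball, dist_comm]; exact hi2), ← mul_assoc, two_mul_rpow]
  have e : α + -(((i + 1 : ℤ) : ℝ) * α) = -((i:ℝ) * α) := by push_cast; ring
  rw [e, ← of_two, ← ENNReal.ofReal_mul (by positivity)]
  apply ENNReal.ofReal_le_ofReal
  rw [mul_comm, Real.rpow_neg (by norm_num), ← div_eq_mul_inv, Real.rpow_mul (by norm_num)]
  gcongr
  exact h0 x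

lemma upper (μ : Measure E) [μ.IsAddHaarMeasure] (h : E → ℝ) (hm : Measurable h)
    (h0 : ∀ x, 0 ≤ h x) (α : ℝ) (hα : 0 < α) (z : E) :
    ∫⁻ x, ENNReal.ofReal (h x / dist z x ^ α) ∂μ ≤ (2:ℝ≥0∞) ^ α * ∑' j : ℤ,
      (2:ℝ≥0∞) ^ (-(j * α)) * ∫⁻ x in ball z ((2:ℝ) ^ (j:ℝ)), ENNReal.ofReal (h x) ∂μ := by
  refine (lintegral_mono fun x => upper_pt h h0 α hα z x).trans (le_of_eq ?_)
  rw [lintegral_const_mul' _ _ (two_ne_top _), lintegral_tsum]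
  · congr 1
    refine tsum_congr fun j => ?_
    rw [lintegral_const_mul' _ _ (two_ne_top _), lintegral_indicator measurableSet_ball]
  · intro j
    exact ((hm.ennreal_ofReal.indicator measurableSet_ball).const_mul _).aemeasurable

variable {F : Type*} [NormedAddCommGroup F] [NormedSpace ℝ F] [FiniteDimensional ℝ F]
  [MeasurableSpace F] [BorelSpace F]

lemma ann_vol (ν : Measure F) [ν.IsAddHaarMeasure] (hk : 1 ≤ Module.finrank ℝ F) (j : ℤ) :
    (2:ℝ≥0∞) ^ ((j:ℝ) * Module.finrank ℝ F) * ν (ball 0 1) ≤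
      ν (ball 0 ((2:ℝ) ^ ((j + 1 : ℤ):ℝ)) \ ball 0 ((2:ℝ) ^ (j:ℝ))) := by
  refine le_trans ?_ le_measure_sdiff
  rw [ball_two, ball_two]
  refine ENNReal.le_sub_of_add_le_right
    (ENNReal.mul_ne_top (two_ne_top _) measure_ball_lt_top.ne) ?_
  rw [← two_mul, ← mul_assoc]
  gcongr
  nth_rw 1 [← ENNReal.rpow_one 2]
  rw [two_mul_rpow]
  refine ENNReal.rpow_le_rpow_of_exponent_le (by norm_num) ?_
  have : (1:ℝ) ≤ Module.finrank ℝ F := by exact_mod_cast hk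
  push_cast
  linarith

lemma lower_pt (μ : Measure E) [μ.IsAddHaarMeasure] (h : E → ℝ)
    (h0 : ∀ x, 0 ≤ h x) (lam β : ℝ) (hl : 0 < lam) (z : E) (j : ℤ) (y : F)
    (hy1 : (2:ℝ) ^ (j:ℝ) ≤ ‖y‖) (hy2 : ‖y‖ < (2:ℝ) ^ ((j + 1 : ℤ):ℝ)) :
    (2:ℝ≥0∞) ^ (-(2 * lam + |β|)) * ((2:ℝ≥0∞) ^ (-(j * (lam + β))) *
      ∫⁻ x in ball z ((2:ℝ) ^ (j:ℝ)), ENNReal.ofReal (h x) ∂μ) ≤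
    ∫⁻ x, ENNReal.ofReal (h x / ((dist x z ^ 2 + ‖y‖ ^ 2) ^ (lam / 2) * ‖y‖ ^ β)) ∂μ := by
  refine le_trans ?_ (setLIntegral_le_lintegral (ball z ((2:ℝ) ^ (j:ℝ))) _)
  rw [← mul_assoc, two_mul_rpow, ← lintegral_const_mul' _ _ (two_ne_top _)]
  refine setLIntegral_mono' measurableSet_ball fun x hx => ?_
  rw [mem_ball] at hx
  rw [← of_two, ← ENNReal.ofReal_mul (by positivity)]
  apply ENNReal.ofReal_le_ofReal
  set t : ℝ := (2:ℝ) ^ (j:ℝ) with ht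
  have htp : 0 < t := by positivity
  have hyp : 0 < ‖y‖ := htp.trans_le hy1
  have hy3 : ‖y‖ ≤ 2 * t := by
    push_cast at hy2
    rw [Real.rpow_add_one (by norm_num)] at hy2
    linarith
  have b1 : (dist x z ^ 2 + ‖y‖ ^ 2) ^ (lam / 2) ≤ (2:ℝ) ^ ((j:ℝ) * lam + 2 * lam) := by
    calc (dist x z ^ 2 + ‖y‖ ^ 2) ^ (lam / 2) ≤ ((4 * t) ^ (2:ℝ)) ^ (lam / 2) := by
          refine Real.rpow_le_rpow (by positivity) ?_ (by positivity)
          rw [Real.rpow_two]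
          have := dist_nonneg (x := x) (y := z)
          nlinarith
      _ = (4 * t) ^ lam := by
          rw [← Real.rpow_mul (by positivity)]; congr 1; ring
      _ = _ := by
          rw [show (4:ℝ) = 2 ^ (2:ℝ) by norm_num, ht, ← Real.rpow_add (by norm_num),
            ← Real.rpow_mul (by norm_num)]
          congr 1; ring
  have b2 : ‖y‖ ^ β ≤ (2:ℝ) ^ ((j:ℝ) * β + |β|) := by
    have e : (2:ℝ) ^ ((j:ℝ) * β + |β|) = t ^ β * 2 ^ |β| := by
      rw [Real.rpow_add (by norm_num), ht, ← Real.rpow_mul (by norm_num)]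
    rw [e]
    rcases le_total 0 β with hb | hb
    · rw [abs_of_nonneg hb, ← Real.mul_rpow htp.le (by norm_num)]
      exact Real.rpow_le_rpow hyp.le (by linarith) hb
    · calc ‖y‖ ^ β ≤ t ^ β := Real.rpow_le_rpow_of_nonpos htp hy1 hb
        _ ≤ _ := le_mul_of_one_le_right (by positivity)
          (Real.one_le_rpow (by norm_num) (abs_nonneg _))
  have hden : 0 < (dist x z ^ 2 + ‖y‖ ^ 2) ^ (lam / 2) * ‖y‖ ^ β := by positivity
  rw [le_div_iff₀ hden]
  calc _ ≤ (2:ℝ) ^ (-(2 * lam + |β|) + -(j * (lam + β))) * h x *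
        ((2:ℝ) ^ ((j:ℝ) * lam + 2 * lam) * (2:ℝ) ^ ((j:ℝ) * β + |β|)) := by
        have := h0 x
        gcongr
    _ = h x * ((2:ℝ) ^ (-(2 * lam + |β|) + -(j * (lam + β))) *
        ((2:ℝ) ^ ((j:ℝ) * lam + 2 * lam) * (2:ℝ) ^ ((j:ℝ) * β + |β|))) := by ring
    _ = h x * (2:ℝ) ^ (0:ℝ) := by
        rw [← Real.rpow_add (by norm_num), ← Real.rpow_add (by norm_num)]
        congr 2; ring
    _ = h x := by simp

lemma lower (μ : Measure E) [μ.IsAddHaarMeasure] (ν : Measure F) [ν.IsAddHaarMeasure]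
    (hk : 1 ≤ Module.finrank ℝ F) (h : E → ℝ)
    (h0 : ∀ x, 0 ≤ h x) (lam β q : ℝ) (hl : 0 < lam) (hq : 1 ≤ q) (z : E) :
    (ν (ball 0 1) * ((2:ℝ≥0∞) ^ (-(2 * lam + |β|))) ^ q) *
      ∑' j : ℤ, ((2:ℝ≥0∞) ^ (-(j * (lam - Module.finrank ℝ F / q + β))) *
        ∫⁻ x in ball z ((2:ℝ) ^ (j:ℝ)), ENNReal.ofReal (h x) ∂μ) ^ q ≤
    ∫⁻ y, (∫⁻ x, ENNReal.ofReal
      (h x / ((dist x z ^ 2 + ‖y‖ ^ 2) ^ (lam / 2) * ‖y‖ ^ β)) ∂μ) ^ q ∂ν := by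
  have hq0 : 0 < q := by linarith
  set s : ℤ → Set F := fun j => ball 0 ((2:ℝ) ^ ((j + 1 : ℤ):ℝ)) \ ball 0 ((2:ℝ) ^ (j:ℝ)) with hs
  have hsm : ∀ j, MeasurableSet (s j) := fun j => measurableSet_ball.diff measurableSet_ball
  have hlt : ∀ i j : ℤ, i < j → Disjoint (s i) (s j) := by
    intro i j hij
    rw [Set.disjoint_left]
    intro y hy hy'
    apply hy'.2
    refine ball_subset_ball ?_ hy.1
    refine Real.rpow_le_rpow_of_exponent_le (by norm_num) ?_
    exact_mod_cast hij
  have hsd : Pairwise (Function.onFun Disjoint s) := by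
    intro i j hij
    rcases lt_or_gt_of_ne hij with h | h
    · exact hlt i j h
    · exact (hlt j i h).symm
  refine le_trans ?_ (setLIntegral_le_lintegral (⋃ j, s j) _)
  rw [lintegral_iUnion hsm hsd, ← ENNReal.tsum_mul_left]
  refine ENNReal.tsum_le_tsum fun j => ?_
  set A := ∫⁻ x in ball z ((2:ℝ) ^ (j:ℝ)), ENNReal.ofReal (h x) ∂μ with hA
  calc _ = ((2:ℝ≥0∞) ^ (-(2 * lam + |β|)) * ((2:ℝ≥0∞) ^ (-(j * (lam + β))) * A)) ^ q *
        ((2:ℝ≥0∞) ^ ((j:ℝ) * Module.finrank ℝ F) * ν (ball 0 1)) := by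
        simp_rw [ENNReal.mul_rpow_of_nonneg _ _ hq0.le]
        have : ((2:ℝ≥0∞) ^ (-(j * (lam - Module.finrank ℝ F / q + β)))) ^ q =
          ((2:ℝ≥0∞) ^ (-(j * (lam + β)))) ^ q * (2:ℝ≥0∞) ^ ((j:ℝ) * Module.finrank ℝ F) := by
          rw [← ENNReal.rpow_mul, ← ENNReal.rpow_mul, two_mul_rpow]
          congr 1
          field_simp
          ring
        rw [this]; ring
    _ ≤ ((2:ℝ≥0∞) ^ (-(2 * lam + |β|)) * ((2:ℝ≥0∞) ^ (-(j * (lam + β))) * A)) ^ q *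
        ν (s j) := by
        gcongr
        exact ann_vol ν hk j
    _ = ∫⁻ y in s j,
        ((2:ℝ≥0∞) ^ (-(2 * lam + |β|)) * ((2:ℝ≥0∞) ^ (-(j * (lam + β))) * A)) ^ q ∂ν := by
        rw [setLIntegral_const]
    _ ≤ _ := by
        refine setLIntegral_mono' (hsm j) fun y hy => ?_
        refine ENNReal.rpow_le_rpow ?_ hq0.le
        have h1 := hy.1
        have h2 := hy.2
        rw [mem_ball_zero_iff] at h1 h2
        exact lower_pt μ h h0 lam β hl z j y (not_lt.1 h2) h1

end Wolff

theorem stmt_6 (n k : ℕ) (hk : 1 ≤ k) (hkn : k < n) (lam β q : ℝ)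
    (hlam : 0 < lam) (hq : 1 ≤ q)
    (h1 : 0 < lam - k / q + β) (h2 : lam - k / q + β < (n : ℝ) - k) :
    ∃ C : ℝ, 0 < C ∧
      ∀ h : EuclideanSpace ℝ (Fin (n - k)) → ℝ, Measurable h → (∀ x, 0 ≤ h x) →
        ∫⁻ z : EuclideanSpace ℝ (Fin (n - k)),
            (∫⁻ x, ENNReal.ofReal (h x / dist z x ^ (lam - k / q + β))) ^ q
          ≤ ENNReal.ofReal C *
            ∫⁻ y : EuclideanSpace ℝ (Fin (n - k)) × EuclideanSpace ℝ (Fin k),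
              (∫⁻ x, ENNReal.ofReal
                (h x / ((dist x y.1 ^ 2 + ‖y.2‖ ^ 2) ^ (lam / 2) * ‖y.2‖ ^ β))) ^ q := by
  have hq0 : 0 < q := by linarith
  have hd : Module.finrank ℝ (EuclideanSpace ℝ (Fin (n - k))) = n - k := by simp
  have hdk : Module.finrank ℝ (EuclideanSpace ℝ (Fin k)) = k := by simp
  obtain ⟨C, hC, hW⟩ := wolff (volume : Measure (EuclideanSpace ℝ (Fin (n - k))))
    (lam - k / q + β) q hq (by rw [hd, Nat.cast_sub hkn.le]; exact h2)
  set c : ℝ≥0∞ := (volume (Metric.ball (0 : EuclideanSpace ℝ (Fin k)) 1) *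
    ((2:ℝ≥0∞) ^ (-(2 * lam + |β|))) ^ q) with hc
  have hc0 : c ≠ 0 := by
    refine mul_ne_zero (Metric.measure_ball_pos _ _ one_pos).ne' ?_
    rw [← ENNReal.rpow_mul]
    exact (ENNReal.rpow_pos (by norm_num) (by norm_num)).ne'
  have hct : c ≠ ⊤ := by
    refine ENNReal.mul_ne_top measure_ball_lt_top.ne ?_
    rw [← ENNReal.rpow_mul]
    exact two_ne_top _
  set K : ℝ≥0∞ := ((2:ℝ≥0∞) ^ (lam - k / q + β)) ^ q * (C * c⁻¹) with hK
  have hKt : K ≠ ⊤ := by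
    refine ENNReal.mul_ne_top ?_ (ENNReal.mul_ne_top hC (ENNReal.inv_ne_top.2 hc0))
    rw [← ENNReal.rpow_mul]
    exact two_ne_top _
  refine ⟨K.toReal + 1, by positivity, fun h hm h0 => ?_⟩
  have hKle : K ≤ ENNReal.ofReal (K.toReal + 1) := by
    rw [ENNReal.le_ofReal_iff_toReal_le hKt (by positivity)]; linarith
  refine le_trans ?_ (mul_le_mul' hKle le_rfl)
  have hGm : Measurable fun y : EuclideanSpace ℝ (Fin (n - k)) × EuclideanSpace ℝ (Fin k) =>
      (∫⁻ x, ENNReal.ofReal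
        (h x / ((dist x y.1 ^ 2 + ‖y.2‖ ^ 2) ^ (lam / 2) * ‖y.2‖ ^ β))) ^ q := by
    refine Measurable.pow_const ?_ q
    refine Measurable.lintegral_prod_right' (f := fun p : (EuclideanSpace ℝ (Fin (n - k)) ×
      EuclideanSpace ℝ (Fin k)) × EuclideanSpace ℝ (Fin (n - k)) => ENNReal.ofReal
        (h p.2 / ((dist p.2 p.1.1 ^ 2 + ‖p.1.2‖ ^ 2) ^ (lam / 2) * ‖p.1.2‖ ^ β))) ?_
    fun_prop
  rw [Measure.volume_eq_prod, lintegral_prod _ hGm.aemeasurable]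
  calc _ ≤ ∫⁻ z : EuclideanSpace ℝ (Fin (n - k)),
        ((2:ℝ≥0∞) ^ (lam - k / q + β) * ∑' j : ℤ, (2:ℝ≥0∞) ^ (-(j * (lam - k / q + β))) *
          ∫⁻ x in Metric.ball z ((2:ℝ) ^ (j:ℝ)), ENNReal.ofReal (h x)) ^ q :=
        lintegral_mono fun z => ENNReal.rpow_le_rpow (upper volume h hm h0 _ h1 z) hq0.le
    _ = ((2:ℝ≥0∞) ^ (lam - k / q + β)) ^ q * ∫⁻ z : EuclideanSpace ℝ (Fin (n - k)),
        (∑' j : ℤ, (2:ℝ≥0∞) ^ (-(j * (lam - k / q + β))) *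
          ∫⁻ x in Metric.ball z ((2:ℝ) ^ (j:ℝ)), ENNReal.ofReal (h x)) ^ q := by
        simp_rw [ENNReal.mul_rpow_of_nonneg _ _ hq0.le]
        rw [lintegral_const_mul']
        rw [← ENNReal.rpow_mul]
        exact two_ne_top _
    _ ≤ ((2:ℝ≥0∞) ^ (lam - k / q + β)) ^ q * (C * ∑' j : ℤ,
        ∫⁻ z : EuclideanSpace ℝ (Fin (n - k)),
        ((2:ℝ≥0∞) ^ (-(j * (lam - k / q + β))) *
          ∫⁻ x in Metric.ball z ((2:ℝ) ^ (j:ℝ)), ENNReal.ofReal (h x)) ^ q) :=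
        mul_le_mul' le_rfl (hW _ hm.ennreal_ofReal)
    _ = ((2:ℝ≥0∞) ^ (lam - k / q + β)) ^ q * (C * (c⁻¹ *
        ∫⁻ z : EuclideanSpace ℝ (Fin (n - k)), c * ∑' j : ℤ,
        ((2:ℝ≥0∞) ^ (-(j * (lam - k / q + β))) *
          ∫⁻ x in Metric.ball z ((2:ℝ) ^ (j:ℝ)), ENNReal.ofReal (h x)) ^ q)) := by
        rw [lintegral_const_mul' _ _ hct, ← mul_assoc c⁻¹, ENNReal.inv_mul_cancel hc0 hct, one_mul,
          lintegral_tsum]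
        intro j
        exact (((A_meas volume _ hm.ennreal_ofReal _).const_mul _).pow_const q).aemeasurable
    _ ≤ ((2:ℝ≥0∞) ^ (lam - k / q + β)) ^ q * (C * (c⁻¹ *
        ∫⁻ z : EuclideanSpace ℝ (Fin (n - k)), ∫⁻ y : EuclideanSpace ℝ (Fin k),
          (∫⁻ x, ENNReal.ofReal
            (h x / ((dist x z ^ 2 + ‖y‖ ^ 2) ^ (lam / 2) * ‖y‖ ^ β))) ^ q)) := by
        refine mul_le_mul' le_rfl (mul_le_mul' le_rfl (mul_le_mul' le_rfl
          (lintegral_mono fun z => ?_)))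
        have := lower (volume : Measure (EuclideanSpace ℝ (Fin (n - k))))
          (volume : Measure (EuclideanSpace ℝ (Fin k))) (by rw [hdk]; exact hk) h h0 lam β q
          hlam hq z
        rw [hdk] at this
        exact this
    _ = _ := by
        rw [hK]; simp only [mul_assoc]
end

section
/- Let $n \geq 1$, $0 \leq k < n$, $p, r > 1$, and $\lambda \in (0, n - k/r)$ satisfying $\frac{n-k}{n} \frac{1}{p} + \frac{1}{r} + \frac{\lambda}{n} = 2 - \frac{k}{n}$. Then there exists $C > 0$ such that for all $f \in L^p(\mathbb{R}^{n-k})$ and $g \in L^r(\mathbb{R}^n)$, $\Big| \iint_{\mathbb{R}^n \times \mathbb{R}^{n-k}} \frac{f(x) g(y)}{|x - y|^{\lambda}} dx \, dy \Big| \leq C \|f\|_{L^p(\mathbb{R}^{n-k})} \|g\|_{L^r(\mathbb{R}^n)}$. Moreover, the range $\lambda < n - k/r$ is optimal: the inequality fails for $\lambda \geq n - k/r$. -/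
open MeasureTheory Set

open scoped ENNReal

lemma scale_lint (d : ℕ) (h : EuclideanSpace ℝ (Fin d) → ℝ≥0∞) (hh : Measurable h)
    (ρ : ℝ) (hρ : 0 < ρ) :
    ∫⁻ u, h u = ENNReal.ofReal ρ ^ (d : ℝ) * ∫⁻ u, h (ρ • u) := by
  have h1 := Measure.map_addHaar_smul (volume : Measure (EuclideanSpace ℝ (Fin d))) hρ.ne'
  have h2 : ∫⁻ u, h (ρ • u) = ∫⁻ u, h u ∂(Measure.map (ρ • ·) volume) := by
    rw [lintegral_map hh (measurable_const_smul ρ)]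
  rw [h2, h1, lintegral_smul_measure, smul_eq_mul, ← mul_assoc]
  rw [ENNReal.ofReal_rpow_of_pos hρ, ← ENNReal.ofReal_mul (by positivity)]
  have : ρ ^ (d : ℝ) * |(ρ ^ Module.finrank ℝ (EuclideanSpace ℝ (Fin d)))⁻¹| = 1 := by
    rw [abs_of_pos (by positivity), finrank_euclideanSpace_fin, Real.rpow_natCast]
    exact mul_inv_cancel₀ (by positivity)
  rw [this]; simp

lemma enorm_eq_ofReal' {E : Type*} [NormedAddCommGroup E] (u : E) : ‖u‖ₑ = ENNReal.ofReal ‖u‖ :=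
  (ofReal_norm u).symm

lemma near_fin (d : ℕ) (hd : 1 ≤ d) (μ : ℝ) (hμ : μ < d) :
    ∫⁻ u : EuclideanSpace ℝ (Fin d), (Metric.ball 0 1).indicator (fun u => ‖u‖ₑ ^ (-μ)) u < ⊤ := by
  have hf : Module.finrank ℝ (EuclideanSpace ℝ (Fin d)) = d := finrank_euclideanSpace_fin
  have : Nontrivial (EuclideanSpace ℝ (Fin d)) :=
    Module.nontrivial_of_finrank_pos (R := ℝ) (by omega)
  have h := integrableOn_ball_of_norm_le_rpow (μ := (volume : Measure (EuclideanSpace ℝ (Fin d))))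
    (f := fun u => ‖u‖ ^ (-μ)) (C := 1) (α := μ) (r := 1) (by omega) (by rw [hf]; exact hμ)
    (by refine Filter.Eventually.of_forall fun x => ?_
        rw [Real.norm_of_nonneg (by positivity)]; simp)
    (by apply Measurable.aestronglyMeasurable; fun_prop)
  rw [lintegral_indicator measurableSet_ball]
  refine lt_of_le_of_lt (le_of_eq ?_) h.2
  refine lintegral_congr_ae (ae_restrict_of_ae ?_)
  have h0 : ∀ᵐ x : EuclideanSpace ℝ (Fin d), x ≠ 0 := by
    simp [ae_iff]
  filter_upwards [h0] with x hx
  have : 0 < ‖x‖ := norm_pos_iff.2 hx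
  rw [enorm_eq_ofReal', ENNReal.ofReal_rpow_of_pos this, Real.enorm_of_nonneg (by positivity)]

lemma near_scale (d : ℕ) (hd : 1 ≤ d) (μ : ℝ) (hμ : μ < d) :
    ∃ A : ℝ≥0∞, A ≠ ⊤ ∧ ∀ ρ : ℝ, 0 < ρ →
    ∫⁻ u : EuclideanSpace ℝ (Fin d), (Metric.ball 0 ρ).indicator (fun u => ‖u‖ₑ ^ (-μ)) u
      ≤ A * ENNReal.ofReal ρ ^ (d - μ) := by
  refine ⟨_, (near_fin d hd μ hμ).ne, fun ρ hρ => le_of_eq ?_⟩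
  have hR0 : ENNReal.ofReal ρ ≠ 0 := by simpa using hρ
  rw [scale_lint d _ (Measurable.indicator (by fun_prop) measurableSet_ball) ρ hρ]
  have : ∀ u : EuclideanSpace ℝ (Fin d),
      (Metric.ball 0 ρ).indicator (fun u => ‖u‖ₑ ^ (-μ)) (ρ • u) =
      ENNReal.ofReal ρ ^ (-μ) * (Metric.ball 0 1).indicator (fun u => ‖u‖ₑ ^ (-μ)) u := by
    intro u
    have hm : ρ • u ∈ Metric.ball (0 : EuclideanSpace ℝ (Fin d)) ρ ↔
        u ∈ Metric.ball (0 : EuclideanSpace ℝ (Fin d)) 1 := by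
      simp only [mem_ball_zero_iff, norm_smul, Real.norm_of_nonneg hρ.le]
      constructor <;> intro h <;> nlinarith
    by_cases hu : u ∈ Metric.ball (0 : EuclideanSpace ℝ (Fin d)) 1
    · rw [indicator_of_mem hu, indicator_of_mem (hm.2 hu), enorm_smul,
        ENNReal.mul_rpow_of_ne_top (by simp) (by simp), Real.enorm_of_nonneg hρ.le]
    · rw [indicator_of_notMem hu, indicator_of_notMem (fun h => hu (hm.1 h)), mul_zero]
  simp_rw [this]
  rw [lintegral_const_mul _ (Measurable.indicator (by fun_prop) measurableSet_ball),
    ← mul_assoc, ← ENNReal.rpow_add _ _ hR0 (by simp), mul_comm, sub_eq_add_neg]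

/-- `∫ (t² + |z|²)^{-s/2} dz ≤ C t^{k-s}`. -/
lemma jap_scale (k : ℕ) (s : ℝ) (hs : (k : ℝ) < s) :
    ∃ A : ℝ≥0∞, A ≠ ⊤ ∧ A ≠ 0 ∧ ∀ t : ℝ, 0 ≤ t →
    ∫⁻ z : EuclideanSpace ℝ (Fin k), ENNReal.ofReal (t ^ 2 + ‖z‖ ^ 2) ^ (-s / 2)
      ≤ A * ENNReal.ofReal t ^ (k - s) := by
  have hfin : ∫⁻ z : EuclideanSpace ℝ (Fin k), ENNReal.ofReal (1 + ‖z‖ ^ 2) ^ (-s / 2) < ⊤ := by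
    have h := (integrable_rpow_neg_one_add_norm_sq
      (μ := (volume : Measure (EuclideanSpace ℝ (Fin k)))) (r := s)
      (by rw [finrank_euclideanSpace_fin]; exact hs)).2
    refine lt_of_le_of_lt (le_of_eq ?_) h
    refine lintegral_congr fun z => ?_
    rw [ENNReal.ofReal_rpow_of_pos (by positivity), Real.enorm_of_nonneg (by positivity)]
  refine ⟨_ + 1, ENNReal.add_ne_top.2 ⟨hfin.ne, ENNReal.one_ne_top⟩, by simp, fun t ht => ?_⟩
  rcases ht.eq_or_lt with rfl | ht
  · rw [ENNReal.ofReal_zero, ENNReal.zero_rpow_of_neg (by linarith), ENNReal.mul_top (by simp)]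
    exact le_top
  refine le_trans (le_of_eq ?_) (mul_le_mul_left le_self_add _)
  have hR0 : ENNReal.ofReal t ≠ 0 := by simpa using ht
  rw [scale_lint k _ (by fun_prop) t ht]
  have : ∀ z : EuclideanSpace ℝ (Fin k), ENNReal.ofReal (t ^ 2 + ‖t • z‖ ^ 2) ^ (-s / 2) =
      ENNReal.ofReal t ^ (-s) * ENNReal.ofReal (1 + ‖z‖ ^ 2) ^ (-s / 2) := by
    intro z
    have : t ^ 2 + ‖t • z‖ ^ 2 = t ^ 2 * (1 + ‖z‖ ^ 2) := by
      rw [norm_smul, Real.norm_of_nonneg ht.le]; ring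
    rw [this, ENNReal.ofReal_mul (by positivity), ENNReal.mul_rpow_of_ne_top (by simp) (by simp),
      ENNReal.ofReal_pow ht.le, ← ENNReal.rpow_natCast, ← ENNReal.rpow_mul]
    congr 2
    push_cast; ring
  simp_rw [this]
  rw [lintegral_const_mul _ (by fun_prop),
    ← mul_assoc, ← ENNReal.rpow_add _ _ hR0 (by simp), mul_comm, sub_eq_add_neg]

lemma far_scale (d : ℕ) (s : ℝ) (hs : (d : ℝ) < s) :
    ∃ A : ℝ≥0∞, A ≠ ⊤ ∧ ∀ ρ : ℝ, 0 < ρ →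
    ∫⁻ u : EuclideanSpace ℝ (Fin d), (Metric.ball 0 ρ)ᶜ.indicator (fun u => ‖u‖ₑ ^ (-s)) u
      ≤ A * ENNReal.ofReal ρ ^ (d - s) := by
  obtain ⟨A, hA, -, h⟩ := jap_scale d s hs
  have hs0 : 0 < s := lt_of_le_of_lt (Nat.cast_nonneg d) hs
  refine ⟨ENNReal.ofReal (2 ^ (s / 2)) * A, ENNReal.mul_ne_top (by simp) hA, fun ρ hρ => ?_⟩
  rw [mul_assoc]
  refine le_trans ?_ (mul_le_mul_right (h ρ hρ.le) _)
  rw [← lintegral_const_mul _ (by fun_prop)]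
  refine lintegral_mono fun u => ?_
  by_cases hu : u ∈ (Metric.ball (0 : EuclideanSpace ℝ (Fin d)) ρ)ᶜ
  · rw [indicator_of_mem hu]
    simp only [mem_compl_iff, mem_ball_zero_iff, not_lt] at hu
    have hu0 : 0 < ‖u‖ := by linarith
    rw [enorm_eq_ofReal', ENNReal.ofReal_rpow_of_pos hu0,
      ENNReal.ofReal_rpow_of_pos (by positivity)]
    rw [← ENNReal.ofReal_mul (by positivity)]
    apply ENNReal.ofReal_le_ofReal
    calc ‖u‖ ^ (-s) = 2 ^ (s / 2) * (2 * ‖u‖ ^ 2) ^ (-s / 2) := by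
          rw [Real.mul_rpow (by positivity) (by positivity), ← mul_assoc,
            ← Real.rpow_add (by positivity), ← Real.rpow_natCast ‖u‖ 2,
            ← Real.rpow_mul (by positivity)]
          rw [show s / 2 + -s / 2 = 0 by ring, Real.rpow_zero, one_mul]
          congr 1; push_cast; ring
      _ ≤ _ := by
          apply mul_le_mul_of_nonneg_left _ (by positivity)
          apply Real.rpow_le_rpow_of_nonpos (by positivity) _ (by linarith)
          nlinarith
  · rw [indicator_of_notMem hu]; exact zero_le

/-- Half of HLS: truncated Riesz potential bound. -/
lemma half_hls (d : ℕ) (hd : 1 ≤ d) (μ r : ℝ) (hr : 1 < r) (hμ : μ < d)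
    (hμ2 : (d : ℝ) * (1 - 1 / r) < μ) :
    ∃ C : ℝ≥0∞, C ≠ ⊤ ∧ C ≠ 0 ∧ ∀ (g : EuclideanSpace ℝ (Fin d) → ℝ≥0∞), Measurable g →
      ∫⁻ y, g y ^ r ≤ 1 → ∀ (B : ℝ≥0∞), B ≠ 0 → B ≠ ⊤ → ∀ x,
      ∫⁻ y, {y | g y ≤ B}.indicator g y * ‖x - y‖ₑ ^ (-μ) ≤ C * B ^ (μ * r / d - r + 1) := by
  have hd0 : (0 : ℝ) < d := by exact_mod_cast hd
  have hr0 : 0 < r := by linarith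
  set q := r / (r - 1) with hq
  have hq0 : 0 < q := div_pos hr0 (by linarith)
  have hconj : r.HolderConjugate q := Real.HolderConjugate.conjExponent hr
  have hqinv : 1 / q = 1 - 1 / r := by
    rw [hq]; field_simp
  have hμq : (d : ℝ) < μ * q := by
    have : (d : ℝ) * (1 / q) < μ := by rw [hqinv]; exact hμ2
    rw [mul_one_div, div_lt_iff₀ hq0] at this
    exact this
  obtain ⟨A₁, hA₁, h₁⟩ := near_scale d hd μ hμ
  obtain ⟨A₂, hA₂, h₂⟩ := far_scale d (μ * q) hμq
  refine ⟨A₁ + A₂ ^ (1 / q) + 1, ?_, by simp, fun g hg hg1 B hB0 hBt x => ?_⟩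
  · simp [hA₁, hA₂, ENNReal.rpow_eq_top_iff, hq0.le]
  set b := B.toReal with hb
  have hb0 : 0 < b := ENNReal.toReal_pos hB0 hBt
  have hBb : B = ENNReal.ofReal b := (ENNReal.ofReal_toReal hBt).symm
  set ρ := b ^ (-r / d) with hρ
  have hρ0 : 0 < ρ := by positivity
  have hR : ENNReal.ofReal ρ = B ^ (-r / d) := by
    rw [hBb, ENNReal.ofReal_rpow_of_pos hb0]
  have hgi : Measurable ({y | g y ≤ B}.indicator g) :=
    hg.indicator (measurableSet_le hg measurable_const)
  have hk1 : Measurable fun u : EuclideanSpace ℝ (Fin d) =>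
      (Metric.ball 0 ρ).indicator (fun u => ‖u‖ₑ ^ (-μ)) u :=
    Measurable.indicator (by fun_prop) measurableSet_ball
  have hk2 : Measurable fun u : EuclideanSpace ℝ (Fin d) =>
      (Metric.ball 0 ρ)ᶜ.indicator (fun u => ‖u‖ₑ ^ (-μ)) u :=
    Measurable.indicator (by fun_prop) measurableSet_ball.compl
  have hk2' : Measurable fun y => (Metric.ball 0 ρ)ᶜ.indicator (fun u => ‖u‖ₑ ^ (-μ)) (x - y) :=
    hk2.comp (measurable_const.sub measurable_id)
  have hsplit : ∫⁻ y, {y | g y ≤ B}.indicator g y * ‖x - y‖ₑ ^ (-μ) ≤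
      ∫⁻ y, (B * (Metric.ball 0 ρ).indicator (fun u => ‖u‖ₑ ^ (-μ)) (x - y) +
        g y * (Metric.ball 0 ρ)ᶜ.indicator (fun u => ‖u‖ₑ ^ (-μ)) (x - y)) := by
    refine lintegral_mono fun y => ?_
    by_cases hy : x - y ∈ Metric.ball (0 : EuclideanSpace ℝ (Fin d)) ρ
    · rw [indicator_of_mem hy, indicator_of_notMem (s := (Metric.ball _ ρ)ᶜ) (by simpa using hy),
        mul_zero, add_zero]
      gcongr
      exact indicator_le' (fun y hy => hy) (fun _ _ => zero_le) y
    · rw [indicator_of_notMem hy, indicator_of_mem (s := (Metric.ball _ ρ)ᶜ) (by simpa using hy),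
        mul_zero, zero_add]
      exact mul_le_mul_left (indicator_le_self _ _ _) _
  refine hsplit.trans ?_
  rw [lintegral_add_right _ (by exact hg.mul hk2'),
    lintegral_const_mul _ (by exact hk1.comp (measurable_const.sub measurable_id)),
    lintegral_sub_left_eq_self
      (fun u => (Metric.ball 0 ρ).indicator (fun u => ‖u‖ₑ ^ (-μ)) u) x]
  have hfar : ∫⁻ y, g y * (Metric.ball 0 ρ)ᶜ.indicator (fun u => ‖u‖ₑ ^ (-μ)) (x - y) ≤
      A₂ ^ (1 / q) * B ^ (μ * r / d - r + 1) := by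
    refine (ENNReal.lintegral_mul_le_Lp_mul_Lq volume hconj hg.aemeasurable
      hk2'.aemeasurable).trans ?_
    have e1 : (∫⁻ y, g y ^ r) ^ (1 / r) ≤ 1 := ENNReal.rpow_le_one hg1 (by positivity)
    have e2 : ∫⁻ y, (Metric.ball 0 ρ)ᶜ.indicator (fun u => ‖u‖ₑ ^ (-μ)) (x - y) ^ q ≤
        A₂ * ENNReal.ofReal ρ ^ (d - μ * q) := by
      refine le_trans (le_of_eq ?_) (h₂ ρ hρ0)
      rw [← lintegral_sub_left_eq_self
        (fun u => (Metric.ball 0 ρ)ᶜ.indicator (fun u => ‖u‖ₑ ^ (-(μ * q))) u) x]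
      refine lintegral_congr fun y => ?_
      by_cases hy : x - y ∈ (Metric.ball (0 : EuclideanSpace ℝ (Fin d)) ρ)ᶜ
      · rw [indicator_of_mem hy, indicator_of_mem hy, ← ENNReal.rpow_mul, neg_mul]
      · rw [indicator_of_notMem hy, indicator_of_notMem hy, ENNReal.zero_rpow_of_pos hq0]
    calc _ ≤ 1 * (A₂ * ENNReal.ofReal ρ ^ (d - μ * q)) ^ (1 / q) := by gcongr
      _ = _ := by
        rw [one_mul, ENNReal.mul_rpow_of_nonneg _ _ (by positivity), hR, ← ENNReal.rpow_mul,
          ← ENNReal.rpow_mul]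
        congr 2
        rw [hqinv]
        have : μ * q * (1 / q) = μ := by field_simp
        have : (d - μ * q) * (1 - 1 / r) = d * (1 - 1 / r) - μ := by
          rw [← hqinv, sub_mul, this]
        rw [this]; field_simp; ring
  have hnear : B * ∫⁻ u : EuclideanSpace ℝ (Fin d),
      (Metric.ball 0 ρ).indicator (fun u => ‖u‖ₑ ^ (-μ)) u ≤ A₁ * B ^ (μ * r / d - r + 1) := by
    calc _ ≤ B * (A₁ * ENNReal.ofReal ρ ^ (d - μ)) := by gcongr; exact h₁ ρ hρ0
      _ = A₁ * (B ^ (1 : ℝ) * B ^ (-r / d * (d - μ))) := by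
        rw [hR, ← ENNReal.rpow_mul, ENNReal.rpow_one]; ring
      _ = _ := by
        rw [← ENNReal.rpow_add _ _ hB0 hBt]
        congr 2; field_simp; ring
  calc _ ≤ A₁ * B ^ (μ * r / d - r + 1) + A₂ ^ (1 / q) * B ^ (μ * r / d - r + 1) :=
        add_le_add hnear hfar
    _ ≤ _ := by rw [add_mul, add_mul]; exact le_self_add

lemma half_hls' (d : ℕ) (hd : 1 ≤ d) (μ p r : ℝ) (hp : 1 < p) (hr : 1 < r) (hμ : μ < d)
    (hbal : μ = d * (2 - 1 / p - 1 / r)) :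
    ∃ C : ℝ≥0∞, C ≠ ⊤ ∧ ∀ (f g : EuclideanSpace ℝ (Fin d) → ℝ≥0∞), Measurable f → Measurable g →
      ∫⁻ x, f x ^ p ≤ 1 → ∫⁻ y, g y ^ r ≤ 1 →
      ∫⁻ x, f x * ∫⁻ y, {y | g y ≤ f x ^ (p / r)}.indicator g y * ‖x - y‖ₑ ^ (-μ) ≤ C := by
  have hd0 : (0 : ℝ) < d := by exact_mod_cast hd
  have hr0 : 0 < r := by linarith
  have hp0 : 0 < p := by linarith
  have hp1 : 1 / p < 1 := by rw [div_lt_one hp0]; exact hp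
  obtain ⟨C, hC, hC0, h⟩ := half_hls d hd μ r hr hμ (by rw [hbal]; gcongr; linarith)
  refine ⟨C, hC, fun f g hf hg hf1 hg1 => ?_⟩
  calc _ ≤ ∫⁻ x, C * f x ^ p := by
        refine lintegral_mono fun x => ?_
        by_cases h0 : f x = 0
        · simp [h0]
        by_cases ht : f x = ⊤
        · rw [ht, ENNReal.top_rpow_of_pos hp0, ENNReal.mul_top hC0]; exact le_top
        refine (mul_le_mul_right (h g hg hg1 (f x ^ (p / r)) ?_ ?_ x) (f x)).trans (le_of_eq ?_)
        · simp [ENNReal.rpow_eq_zero_iff, h0, ht]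
        · simp [ENNReal.rpow_eq_top_iff, h0, ht]
        · rw [← ENNReal.rpow_mul]
          have : p / r * (μ * r / d - r + 1) = p - 1 := by
            rw [hbal]; field_simp; ring
          rw [this, mul_left_comm]
          congr 1
          nth_rewrite 1 [← ENNReal.rpow_one (f x)]
          rw [← ENNReal.rpow_add _ _ h0 ht]
          congr 1; ring
    _ = C * ∫⁻ x, f x ^ p := lintegral_const_mul _ (by fun_prop)
    _ ≤ C * 1 := by gcongr
    _ = C := mul_one C

lemma hls_norm (d : ℕ) (hd : 1 ≤ d) (μ p r : ℝ) (hp : 1 < p) (hr : 1 < r) (hμ : μ < d)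
    (hbal : μ = d * (2 - 1 / p - 1 / r)) :
    ∃ C : ℝ≥0∞, C ≠ ⊤ ∧ ∀ (f g : EuclideanSpace ℝ (Fin d) → ℝ≥0∞), Measurable f → Measurable g →
      ∫⁻ x, f x ^ p ≤ 1 → ∫⁻ y, g y ^ r ≤ 1 →
      ∫⁻ x, ∫⁻ y, f x * g y * ‖x - y‖ₑ ^ (-μ) ≤ C := by
  have hr0 : 0 < r := by linarith
  have hp0 : 0 < p := by linarith
  obtain ⟨C₁, hC₁, h₁⟩ := half_hls' d hd μ p r hp hr hμ hbal
  obtain ⟨C₂, hC₂, h₂⟩ := half_hls' d hd μ r p hr hp hμ (by rw [hbal]; ring)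
  refine ⟨C₁ + C₂, by simp [hC₁, hC₂], fun f g hf hg hf1 hg1 => ?_⟩
  have m1 : Measurable fun q : EuclideanSpace ℝ (Fin d) × EuclideanSpace ℝ (Fin d) =>
      f q.1 * ({y | g y ≤ f q.1 ^ (p / r)}.indicator g q.2 * ‖q.1 - q.2‖ₑ ^ (-μ)) := by
    have : Measurable fun q : EuclideanSpace ℝ (Fin d) × EuclideanSpace ℝ (Fin d) =>
        {q : EuclideanSpace ℝ (Fin d) × EuclideanSpace ℝ (Fin d) |
          g q.2 ≤ f q.1 ^ (p / r)}.indicator (fun q => g q.2) q :=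
      Measurable.indicator (by fun_prop) (measurableSet_le (by fun_prop) (by fun_prop))
    refine (hf.comp measurable_fst).mul (Measurable.mul this (by fun_prop))
  have m2 : Measurable fun q : EuclideanSpace ℝ (Fin d) × EuclideanSpace ℝ (Fin d) =>
      g q.2 * ({x | f x ≤ g q.2 ^ (r / p)}.indicator f q.1 * ‖q.2 - q.1‖ₑ ^ (-μ)) := by
    have : Measurable fun q : EuclideanSpace ℝ (Fin d) × EuclideanSpace ℝ (Fin d) =>
        {q : EuclideanSpace ℝ (Fin d) × EuclideanSpace ℝ (Fin d) |
          f q.1 ≤ g q.2 ^ (r / p)}.indicator (fun q => f q.1) q :=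
      Measurable.indicator (by fun_prop) (measurableSet_le (by fun_prop) (by fun_prop))
    refine (hg.comp measurable_snd).mul (Measurable.mul this (by fun_prop))
  calc _ ≤ ∫⁻ x, ∫⁻ y,
        (f x * ({y | g y ≤ f x ^ (p / r)}.indicator g y * ‖x - y‖ₑ ^ (-μ)) +
        g y * ({x | f x ≤ g y ^ (r / p)}.indicator f x * ‖y - x‖ₑ ^ (-μ))) := by
        refine lintegral_mono fun x => lintegral_mono fun y => ?_
        rcases le_total (g y ^ r) (f x ^ p) with hle | hle
        · have : g y ≤ f x ^ (p / r) := by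
            have := ENNReal.rpow_le_rpow hle (z := 1 / r) (by positivity)
            rwa [← ENNReal.rpow_mul, ← ENNReal.rpow_mul, mul_one_div, mul_one_div,
              div_self hr0.ne', ENNReal.rpow_one] at this
          rw [indicator_of_mem (by exact this), ← mul_assoc]
          exact le_self_add
        · have : f x ≤ g y ^ (r / p) := by
            have := ENNReal.rpow_le_rpow hle (z := 1 / p) (by positivity)
            rwa [← ENNReal.rpow_mul, ← ENNReal.rpow_mul, mul_one_div, mul_one_div,
              div_self hp0.ne', ENNReal.rpow_one] at this
          rw [indicator_of_mem (s := {x | f x ≤ g y ^ (r / p)}) (by exact this),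
            ← mul_assoc (g y), mul_comm (g y) (f x), enorm_sub_rev y x]
          exact le_add_self
    _ = (∫⁻ x, ∫⁻ y, f x * ({y | g y ≤ f x ^ (p / r)}.indicator g y * ‖x - y‖ₑ ^ (-μ))) +
        ∫⁻ x, ∫⁻ y, g y * ({x | f x ≤ g y ^ (r / p)}.indicator f x * ‖y - x‖ₑ ^ (-μ)) := by
        rw [← lintegral_add_left m1.lintegral_prod_right']
        refine lintegral_congr fun x => ?_
        exact lintegral_add_left (m1.comp (measurable_prodMk_left (x := x))) _
    _ ≤ C₁ + C₂ := by
        refine add_le_add ?_ ?_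
        · refine le_trans (le_of_eq (lintegral_congr fun x => ?_)) (h₁ f g hf hg hf1 hg1)
          refine lintegral_const_mul _ (Measurable.mul ?_ (by fun_prop))
          exact hg.indicator (measurableSet_le hg measurable_const)
        · rw [lintegral_lintegral_swap (by exact m2.aemeasurable)]
          refine le_trans (le_of_eq (lintegral_congr fun x => ?_)) (h₂ g f hg hf hg1 hf1)
          refine lintegral_const_mul _ (Measurable.mul ?_ (by fun_prop))
          exact hf.indicator (measurableSet_le hf measurable_const)

lemma hls (d : ℕ) (hd : 1 ≤ d) (μ p r : ℝ) (hp : 1 < p) (hr : 1 < r) (hμ : μ < d)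
    (hbal : μ = d * (2 - 1 / p - 1 / r)) :
    ∃ C : ℝ≥0∞, C ≠ ⊤ ∧ ∀ (f g : EuclideanSpace ℝ (Fin d) → ℝ≥0∞), Measurable f → Measurable g →
      ∫⁻ x, ∫⁻ y, f x * g y * ‖x - y‖ₑ ^ (-μ) ≤
        C * (∫⁻ x, f x ^ p) ^ (1 / p) * (∫⁻ y, g y ^ r) ^ (1 / r) := by
  have hr0 : 0 < r := by linarith
  have hp0 : 0 < p := by linarith
  obtain ⟨C, hC, h⟩ := hls_norm d hd μ p r hp hr hμ hbal
  refine ⟨C + 1, by simp [hC], fun f g hf hg => ?_⟩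
  set I := ∫⁻ x, f x ^ p with hI
  set J := ∫⁻ y, g y ^ r with hJ
  by_cases hI0 : I = 0
  · rw [hI, lintegral_eq_zero_iff (by fun_prop)] at hI0
    have : ∫⁻ x, ∫⁻ y, f x * g y * ‖x - y‖ₑ ^ (-μ) = ∫⁻ _ : EuclideanSpace ℝ (Fin d), 0 := by
      refine lintegral_congr_ae ?_
      filter_upwards [hI0] with x hx
      have : f x = 0 := by simpa [hp0, hp0.le, not_lt.2 hp0.le] using hx
      simp [this]
    rw [this]; simp
  by_cases hJ0 : J = 0
  · rw [hJ, lintegral_eq_zero_iff (by fun_prop)] at hJ0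
    have : ∫⁻ x, ∫⁻ y, f x * g y * ‖x - y‖ₑ ^ (-μ) = ∫⁻ _ : EuclideanSpace ℝ (Fin d), 0 := by
      refine lintegral_congr fun x => ?_
      rw [show (0 : ℝ≥0∞) = ∫⁻ y : EuclideanSpace ℝ (Fin d), 0 by simp]
      refine lintegral_congr_ae ?_
      filter_upwards [hJ0] with x hx
      have : g x = 0 := by simpa [hr0, hr0.le, not_lt.2 hr0.le] using hx
      simp [this]
    rw [this]; simp
  set P := I ^ (1 / p) with hP
  set Q := J ^ (1 / r) with hQ
  have hP0 : P ≠ 0 := by simp [hP, ENNReal.rpow_eq_zero_iff, hI0, hp0.le]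
  have hQ0 : Q ≠ 0 := by simp [hQ, ENNReal.rpow_eq_zero_iff, hJ0, hr0.le]
  by_cases hPt : P = ⊤
  · rw [hPt, ENNReal.mul_top (by simp), ENNReal.top_mul hQ0]; exact le_top
  by_cases hQt : Q = ⊤
  · rw [hQt, ENNReal.mul_top (by simp [hP0])]; exact le_top
  have hPI : P ^ p = I := by rw [hP, ← ENNReal.rpow_mul]; simp [hp0.ne']
  have hQJ : Q ^ r = J := by rw [hQ, ← ENNReal.rpow_mul]; simp [hr0.ne']
  have key := h (fun x => P⁻¹ * f x) (fun y => Q⁻¹ * g y) (by fun_prop) (by fun_prop) ?_ ?_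
  · have e : ∫⁻ x, ∫⁻ y, f x * g y * ‖x - y‖ₑ ^ (-μ) =
        P * Q * ∫⁻ x, ∫⁻ y, P⁻¹ * f x * (Q⁻¹ * g y) * ‖x - y‖ₑ ^ (-μ) := by
      rw [← lintegral_const_mul' _ _ (ENNReal.mul_ne_top hPt hQt)]
      refine lintegral_congr fun x => ?_
      rw [← lintegral_const_mul' _ _ (ENNReal.mul_ne_top hPt hQt)]
      refine lintegral_congr fun y => ?_
      calc _ = (P * P⁻¹) * (Q * Q⁻¹) * (f x * g y * ‖x - y‖ₑ ^ (-μ)) := by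
            rw [ENNReal.mul_inv_cancel hP0 hPt, ENNReal.mul_inv_cancel hQ0 hQt]; simp
        _ = _ := by ring
    rw [e]
    calc _ ≤ P * Q * C := by gcongr
      _ ≤ P * Q * (C + 1) := by gcongr; exact le_self_add
      _ = _ := by ring
  · simp_rw [ENNReal.mul_rpow_of_nonneg _ _ hp0.le]
    rw [lintegral_const_mul _ (by fun_prop), ENNReal.inv_rpow, hPI, ← hI]
    exact ENNReal.inv_mul_le_one I
  · simp_rw [ENNReal.mul_rpow_of_nonneg _ _ hr0.le]
    rw [lintegral_const_mul _ (by fun_prop), ENNReal.inv_rpow, hQJ, ← hJ]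
    exact ENNReal.inv_mul_le_one J

lemma pos_part (m k : ℕ) (hm : 1 ≤ m) (p r lam : ℝ) (hp : 1 < p) (hr : 1 < r)
    (hbal : (m : ℝ) / p + (m + k) / r + lam = 2 * m + k) (hlam : lam < m + k - k / r) :
      ∃ C : ℝ, 0 < C ∧
        ∀ (f : EuclideanSpace ℝ (Fin m) → ℝ)
          (g : EuclideanSpace ℝ (Fin m) × EuclideanSpace ℝ (Fin k) → ℝ),
          Measurable f → Measurable g → (∀ x, 0 ≤ f x) → (∀ y, 0 ≤ g y) →
          ∫⁻ y : EuclideanSpace ℝ (Fin m) × EuclideanSpace ℝ (Fin k),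
              ∫⁻ x, ENNReal.ofReal
                (f x * g y / (dist x y.1 ^ 2 + ‖y.2‖ ^ 2) ^ (lam / 2))
            ≤ ENNReal.ofReal C * eLpNorm f (ENNReal.ofReal p) volume *
                eLpNorm g (ENNReal.ofReal r) volume := by
  have hm0 : (0 : ℝ) < m := by exact_mod_cast hm
  have hr0 : 0 < r := by linarith
  have hp0 : 0 < p := by linarith
  set q := r / (r - 1) with hq
  have hq0 : 0 < q := div_pos hr0 (by linarith)
  have hconj : r.HolderConjugate q := Real.HolderConjugate.conjExponent hr
  have hqinv : 1 / q = 1 - 1 / r := by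
    rw [hq]; field_simp
  set μ := lam - k * (1 - 1 / r) with hμ
  have hbal' : μ = m * (2 - 1 / p - 1 / r) := by
    have e1 : lam = 2 * m + k - (m / p + (m + k) / r) := by linarith
    rw [hμ, e1]; field_simp; ring
  have hμm : μ < m := by
    have : (k : ℝ) * (1 - 1 / r) = k - k / r := by ring
    rw [hμ, this]; linarith
  have hμ0 : 0 < μ := by
    have h1 : 1 / p < 1 := by rw [div_lt_one hp0]; exact hp
    have h2 : 1 / r < 1 := by rw [div_lt_one hr0]; exact hr
    rw [hbal']; apply mul_pos hm0; linarith
  have hkq : (k : ℝ) < lam * q := by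
    have : (k : ℝ) * (1 / q) < lam := by rw [hqinv]; linarith
    rwa [mul_one_div, div_lt_iff₀ hq0] at this
  obtain ⟨C, hC, hH⟩ := hls m hm μ p r hp hr hμm hbal'
  obtain ⟨A, hA, hA0, hJ⟩ := jap_scale k (lam * q) hkq
  set D := A ^ (1 / q) with hD
  have hDt : D ≠ ⊤ := by simp [hD, hA, hq0.le]
  have hDC : D * C ≠ ⊤ := ENNReal.mul_ne_top hDt hC
  refine ⟨(D * C).toReal + 1, by positivity, fun f g hf hg hf0 hg0 => ?_⟩
  set F : EuclideanSpace ℝ (Fin m) → ℝ≥0∞ := fun x => ENNReal.ofReal (f x) with hF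
  set G : EuclideanSpace ℝ (Fin m) × EuclideanSpace ℝ (Fin k) → ℝ≥0∞ :=
    fun y => ENNReal.ofReal (g y) with hG
  have hFm : Measurable F := by fun_prop
  have hGm : Measurable G := by fun_prop
  set H : EuclideanSpace ℝ (Fin m) → ℝ≥0∞ := fun y => (∫⁻ z, G (y, z) ^ r) ^ (1 / r) with hHdef
  have hHm : Measurable H := by
    have : Measurable fun y => ∫⁻ z, G (y, z) ^ r :=
      Measurable.lintegral_prod_right' (f := fun y => G y ^ r) (by fun_prop)
    fun_prop
  set K : EuclideanSpace ℝ (Fin m) → EuclideanSpace ℝ (Fin k) → ℝ≥0∞ :=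
    fun u z => ENNReal.ofReal (‖u‖ ^ 2 + ‖z‖ ^ 2) ^ (-lam / 2) with hK
  have hKm : Measurable fun w : EuclideanSpace ℝ (Fin m) × EuclideanSpace ℝ (Fin k) =>
      K w.1 w.2 := by fun_prop
  have hfn : eLpNorm f (ENNReal.ofReal p) volume = (∫⁻ x, F x ^ p) ^ (1 / p) := by
    rw [eLpNorm_eq_lintegral_rpow_enorm_toReal (by simpa using hp0) (by simp),
      ENNReal.toReal_ofReal hp0.le]
    congr 1
    refine lintegral_congr fun x => ?_
    rw [Real.enorm_of_nonneg (hf0 x)]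
  have hgn : eLpNorm g (ENNReal.ofReal r) volume = (∫⁻ y, H y ^ r) ^ (1 / r) := by
    rw [eLpNorm_eq_lintegral_rpow_enorm_toReal (by simpa using hr0) (by simp),
      ENNReal.toReal_ofReal hr0.le]
    congr 1
    have : ∀ y, H y ^ r = ∫⁻ z, G (y, z) ^ r := by
      intro y
      rw [hHdef]
      simp only
      rw [← ENNReal.rpow_mul, one_div_mul_cancel hr0.ne', ENNReal.rpow_one]
    simp_rw [this]
    rw [← lintegral_prod (fun y => G y ^ r) (by fun_prop), ← Measure.volume_eq_prod]
    refine lintegral_congr fun x => ?_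
    rw [Real.enorm_of_nonneg (hg0 x)]
  have hin : ∀ x y, ∫⁻ z, G (y, z) * K (x - y) z ≤ D * (H y * ‖x - y‖ₑ ^ (-μ)) := by
    intro x y
    have hmz : Measurable fun z => K (x - y) z := by
      simp only [hK]; fun_prop
    have hmg : Measurable fun z => G (y, z) := hGm.comp (measurable_prodMk_left (x := y))
    have hol : ∫⁻ z, G (y, z) * K (x - y) z ≤
        (∫⁻ z, G (y, z) ^ r) ^ (1 / r) * (∫⁻ z, K (x - y) z ^ q) ^ (1 / q) :=
      ENNReal.lintegral_mul_le_Lp_mul_Lq volume hconj hmg.aemeasurable hmz.aemeasurable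
    have hHy : (∫⁻ z, G (y, z) ^ r) ^ (1 / r) = H y := rfl
    rw [hHy] at hol
    refine hol.trans ?_
    have e : (∫⁻ z, K (x - y) z ^ q) ^ (1 / q) ≤ D * ‖x - y‖ₑ ^ (-μ) := by
      have e1 : ∫⁻ z, K (x - y) z ^ q ≤ A * ENNReal.ofReal ‖x - y‖ ^ (k - lam * q) := by
        refine le_trans (le_of_eq (lintegral_congr fun z => ?_)) (hJ ‖x - y‖ (norm_nonneg _))
        rw [hK]
        simp only
        rw [← ENNReal.rpow_mul]
        congr 1; ring
      calc _ ≤ (A * ENNReal.ofReal ‖x - y‖ ^ (k - lam * q)) ^ (1 / q) := by gcongr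
        _ = _ := by
          rw [ENNReal.mul_rpow_of_nonneg _ _ (by positivity), ← ENNReal.rpow_mul,
            ← enorm_eq_ofReal']
          congr 2
          rw [sub_mul, hμ, ← hqinv]
          field_simp; ring
    calc _ ≤ H y * (D * ‖x - y‖ₑ ^ (-μ)) := by gcongr
      _ = _ := by ring
  have hpt : ∀ (x : EuclideanSpace ℝ (Fin m))
      (y : EuclideanSpace ℝ (Fin m) × EuclideanSpace ℝ (Fin k)), ENNReal.ofReal
      (f x * g y / (dist x y.1 ^ 2 + ‖y.2‖ ^ 2) ^ (lam / 2)) ≤ F x * (G y * K (x - y.1) y.2) := by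
    intro x y
    rw [dist_eq_norm]
    have hnn : 0 ≤ ‖x - y.1‖ ^ 2 + ‖y.2‖ ^ 2 := by positivity
    rcases hnn.eq_or_lt with h0 | hpos
    · have hl : lam / 2 ≠ 0 := by
        rintro hl
        have : lam = 0 := by linarith
        have h3 : (0 : ℝ) ≤ k := Nat.cast_nonneg k
        rw [this, zero_mul] at hkq; linarith
      rw [← h0, Real.zero_rpow hl]; simp
    · rw [hK, hF, hG]
      simp only
      rw [ENNReal.ofReal_rpow_of_pos hpos, ← ENNReal.ofReal_mul (hg0 y),
        ← ENNReal.ofReal_mul (hf0 x), neg_div, Real.rpow_neg hnn, div_eq_mul_inv, mul_assoc]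
  calc _ ≤ ∫⁻ y : EuclideanSpace ℝ (Fin m) × EuclideanSpace ℝ (Fin k),
          ∫⁻ x, F x * (G y * K (x - y.1) y.2) :=
        lintegral_mono fun y => lintegral_mono fun x => hpt x y
    _ = ∫⁻ x, ∫⁻ y : EuclideanSpace ℝ (Fin m) × EuclideanSpace ℝ (Fin k),
          F x * (G y * K (x - y.1) y.2) := by
        apply lintegral_lintegral_swap
        apply Measurable.aemeasurable
        simp only [hK, Function.uncurry_def]
        fun_prop
    _ = ∫⁻ x, ∫⁻ y, F x * ∫⁻ z, G (y, z) * K (x - y) z := by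
        refine lintegral_congr fun x => ?_
        have hmm : Measurable fun y : EuclideanSpace ℝ (Fin m) × EuclideanSpace ℝ (Fin k) =>
            G y * K (x - y.1) y.2 := by
          simp only [hK]; fun_prop
        rw [Measure.volume_eq_prod, lintegral_prod _ (by exact (hmm.const_mul _).aemeasurable)]
        refine lintegral_congr fun y => ?_
        exact lintegral_const_mul _ (hmm.comp (measurable_prodMk_left (x := y)))
    _ ≤ ∫⁻ x, ∫⁻ y, D * (F x * H y * ‖x - y‖ₑ ^ (-μ)) := by
        refine lintegral_mono fun x => lintegral_mono fun y => ?_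
        refine (mul_le_mul_right (hin x y) _).trans (le_of_eq ?_)
        ring
    _ = D * ∫⁻ x, ∫⁻ y, F x * H y * ‖x - y‖ₑ ^ (-μ) := by
        rw [← lintegral_const_mul' _ _ hDt]
        refine lintegral_congr fun x => ?_
        exact lintegral_const_mul' _ _ hDt
    _ ≤ D * (C * (∫⁻ x, F x ^ p) ^ (1 / p) * (∫⁻ y, H y ^ r) ^ (1 / r)) := by
        gcongr; exact hH F H hFm hHm
    _ = D * C * eLpNorm f (ENNReal.ofReal p) volume * eLpNorm g (ENNReal.ofReal r) volume := by
        rw [hfn, hgn]; ring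
    _ ≤ _ := by
        gcongr
        rw [ENNReal.le_ofReal_iff_toReal_le hDC (by positivity)]
        linarith

lemma near_inf (d : ℕ) (hd : 1 ≤ d) :
    ∫⁻ u : EuclideanSpace ℝ (Fin d),
      (Metric.ball 0 1).indicator (fun u => ‖u‖ₑ ^ (-(d : ℝ))) u = ⊤ := by
  have hf : Module.finrank ℝ (EuclideanSpace ℝ (Fin d)) = d := finrank_euclideanSpace_fin
  have : Nontrivial (EuclideanSpace ℝ (Fin d)) :=
    Module.nontrivial_of_finrank_pos (R := ℝ) (by omega)
  have hni : ¬ IntegrableOn (fun u : EuclideanSpace ℝ (Fin d) => ‖u‖ ^ (-(d : ℝ)))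
      (Metric.ball 0 1) volume := by
    rw [integrableOn_fun_norm_addHaar volume (f := fun y : ℝ => y ^ (-(d : ℝ))), hf]
    intro h
    have h2 : IntegrableOn (fun y : ℝ => y ^ (-1 : ℝ)) (Ioo 0 1) := by
      refine h.congr_fun ?_ measurableSet_Ioo
      intro y hy
      simp only [smul_eq_mul]
      rw [← Real.rpow_natCast, ← Real.rpow_add hy.1, Nat.cast_sub hd]
      congr 1; push_cast; ring
    rw [intervalIntegral.integrableOn_Ioo_rpow_iff one_pos] at h2
    linarith
  by_contra hne
  apply hni
  refine ⟨by apply Measurable.aestronglyMeasurable; fun_prop, ?_⟩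
  rw [lintegral_indicator measurableSet_ball] at hne
  refine lt_of_le_of_lt (le_of_eq ?_) (lt_top_iff_ne_top.2 hne)
  refine lintegral_congr_ae (ae_restrict_of_ae ?_)
  have h0 : ∀ᵐ x : EuclideanSpace ℝ (Fin d), x ≠ 0 := by
    simp [ae_iff]
  filter_upwards [h0] with x hx
  have : 0 < ‖x‖ := norm_pos_iff.2 hx
  rw [enorm_eq_ofReal' x, ENNReal.ofReal_rpow_of_pos this, Real.enorm_of_nonneg (by positivity)]

/-- Shell integrals are unbounded. -/
lemma shell_sup (d : ℕ) (hd : 1 ≤ d) (M : ℝ≥0∞) (hM : M ≠ ⊤) :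
    ∃ δ : ℝ, 0 < δ ∧ M < ∫⁻ u : EuclideanSpace ℝ (Fin d),
      {u | δ ≤ ‖u‖ ∧ ‖u‖ < 1}.indicator (fun u => ‖u‖ₑ ^ (-(d : ℝ))) u := by
  by_contra! hcon
  have hmeas : ∀ j : ℕ, Measurable ({u : EuclideanSpace ℝ (Fin d) |
      1 / ((j : ℝ) + 1) ≤ ‖u‖ ∧ ‖u‖ < 1}.indicator (fun u => ‖u‖ₑ ^ (-(d : ℝ)))) := by
    intro j
    refine Measurable.indicator (by fun_prop) ?_
    exact (measurableSet_le measurable_const measurable_norm).inter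
      (measurableSet_lt measurable_norm measurable_const)
  have hmono : Monotone fun j : ℕ => {u : EuclideanSpace ℝ (Fin d) |
      1 / ((j : ℝ) + 1) ≤ ‖u‖ ∧ ‖u‖ < 1}.indicator (fun u => ‖u‖ₑ ^ (-(d : ℝ))) := by
    intro i j hij
    refine indicator_le_indicator_of_subset ?_ (fun _ => zero_le)
    rintro u ⟨h1, h2⟩
    refine ⟨le_trans ?_ h1, h2⟩
    exact Nat.one_div_le_one_div hij
  have hsup := lintegral_iSup (μ := volume) hmeas hmono
  have hle : ⨆ j : ℕ, ∫⁻ u : EuclideanSpace ℝ (Fin d), {u : EuclideanSpace ℝ (Fin d) |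
      1 / ((j : ℝ) + 1) ≤ ‖u‖ ∧ ‖u‖ < 1}.indicator (fun u => ‖u‖ₑ ^ (-(d : ℝ))) u ≤ M :=
    iSup_le fun j => hcon _ (by positivity)
  rw [← hsup] at hle
  have h3 := near_inf d hd
  have h0 : ∀ᵐ x : EuclideanSpace ℝ (Fin d), x ≠ 0 := by
    have : Nontrivial (EuclideanSpace ℝ (Fin d)) :=
      Module.nontrivial_of_finrank_pos (R := ℝ) (by rw [finrank_euclideanSpace_fin]; omega)
    simp [ae_iff]
  have h4 : (⊤ : ℝ≥0∞) ≤ M := by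
    rw [← h3]
    refine le_trans (lintegral_mono_ae ?_) hle
    filter_upwards [h0] with u hu
    have hu0 : 0 < ‖u‖ := norm_pos_iff.2 hu
    by_cases hb : u ∈ Metric.ball (0 : EuclideanSpace ℝ (Fin d)) 1
    · obtain ⟨j, hj⟩ := exists_nat_one_div_lt hu0
      refine le_trans ?_ (le_iSup _ j)
      rw [indicator_of_mem hb, indicator_of_mem]
      exact ⟨hj.le, by simpa using hb⟩
    · rw [indicator_of_notMem hb]; exact zero_le
  exact hM (top_le_iff.1 h4)

lemma eLp_ball (m : ℕ) (p : ℝ) :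
    eLpNorm ((Metric.ball (0 : EuclideanSpace ℝ (Fin m)) 2).indicator (fun _ => (1 : ℝ)))
      (ENNReal.ofReal p) volume ≠ ⊤ := by
  have : MemLp ((Metric.ball (0 : EuclideanSpace ℝ (Fin m)) 2).indicator (fun _ => (1 : ℝ)))
      (ENNReal.ofReal p) volume :=
    memLp_indicator_const _ measurableSet_ball _ (Or.inr measure_ball_lt_top.ne)
  exact this.2.ne

lemma neg_part_zero (m : ℕ) (hm : 1 ≤ m) (p r lam : ℝ)
    (hlam : (m : ℝ) ≤ lam) (C : ℝ)
    (h : ∀ (f : EuclideanSpace ℝ (Fin m) → ℝ)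
          (g : EuclideanSpace ℝ (Fin m) × EuclideanSpace ℝ (Fin 0) → ℝ),
          Measurable f → Measurable g → (∀ x, 0 ≤ f x) → (∀ y, 0 ≤ g y) →
          ∫⁻ y : EuclideanSpace ℝ (Fin m) × EuclideanSpace ℝ (Fin 0),
              ∫⁻ x, ENNReal.ofReal
                (f x * g y / (dist x y.1 ^ 2 + ‖y.2‖ ^ 2) ^ (lam / 2))
            ≤ ENNReal.ofReal C * eLpNorm f (ENNReal.ofReal p) volume *
                eLpNorm g (ENNReal.ofReal r) volume) : False := by
  set S : Set (EuclideanSpace ℝ (Fin m) × EuclideanSpace ℝ (Fin 0)) :=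
    Metric.ball 0 1 ×ˢ univ with hS
  have hSm : MeasurableSet S := measurableSet_ball.prod MeasurableSet.univ
  have hvS : volume S = volume (Metric.ball (0 : EuclideanSpace ℝ (Fin m)) 1) *
      volume (univ : Set (EuclideanSpace ℝ (Fin 0))) := by
    rw [hS, Measure.volume_eq_prod, Measure.prod_prod]
  have hu : (univ : Set (EuclideanSpace ℝ (Fin 0))) = Metric.ball 0 1 := by
    ext z; simp [Subsingleton.elim z 0]
  have hSt : volume S ≠ ⊤ := by
    rw [hvS, hu]
    exact ENNReal.mul_ne_top measure_ball_lt_top.ne measure_ball_lt_top.ne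
  have hS0 : volume S ≠ 0 := by
    rw [hvS, hu]
    exact mul_ne_zero (Metric.measure_ball_pos _ _ one_pos).ne'
      (Metric.measure_ball_pos _ _ one_pos).ne'
  have key := h ((Metric.ball 0 2).indicator fun _ => 1) (S.indicator fun _ => 1)
    (measurable_const.indicator measurableSet_ball) (measurable_const.indicator hSm)
    (indicator_nonneg fun _ _ => zero_le_one) (indicator_nonneg fun _ _ => zero_le_one)
  have hg : eLpNorm (S.indicator fun _ => (1 : ℝ)) (ENNReal.ofReal r) volume ≠ ⊤ :=
    (memLp_indicator_const _ hSm _ (Or.inr hSt)).2.ne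
  refine absurd key (not_le.2 (lt_of_lt_of_le (lt_top_iff_ne_top.2
    (ENNReal.mul_ne_top (ENNReal.mul_ne_top (by simp) (eLp_ball m p)) hg)) ?_))
  have hin : ∀ y, S.indicator (fun _ => (⊤ : ℝ≥0∞)) y ≤ ∫⁻ x, ENNReal.ofReal
      ((Metric.ball 0 2).indicator (fun _ => (1 : ℝ)) x * S.indicator (fun _ => (1 : ℝ)) y /
        (dist x y.1 ^ 2 + ‖y.2‖ ^ 2) ^ (lam / 2)) := by
    intro y
    by_cases hy : y ∈ S
    swap
    · rw [indicator_of_notMem hy]; exact zero_le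
    rw [indicator_of_mem hy, ← near_inf m hm, ← lintegral_sub_right_eq_self _ y.1]
    have h0 : ∀ᵐ x : EuclideanSpace ℝ (Fin m), x ≠ y.1 := by
      have : Nontrivial (EuclideanSpace ℝ (Fin m)) :=
        Module.nontrivial_of_finrank_pos (R := ℝ) (by rw [finrank_euclideanSpace_fin]; omega)
      simp [ae_iff]
    refine lintegral_mono_ae ?_
    filter_upwards [h0] with x hx
    have hy1 : ‖y.1‖ < 1 := by simpa [hS] using hy
    have hx0 : 0 < ‖x - y.1‖ := norm_pos_iff.2 (sub_ne_zero.2 hx)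
    by_cases hb : x - y.1 ∈ Metric.ball (0 : EuclideanSpace ℝ (Fin m)) 1
    · have hb1 : ‖x - y.1‖ < 1 := by simpa using hb
      have hx2 : x ∈ Metric.ball (0 : EuclideanSpace ℝ (Fin m)) 2 := by
        rw [mem_ball_zero_iff]
        calc ‖x‖ = ‖(x - y.1) + y.1‖ := by simp
          _ ≤ ‖x - y.1‖ + ‖y.1‖ := norm_add_le _ _
          _ < 2 := by linarith
      rw [indicator_of_mem hb, indicator_of_mem hx2, indicator_of_mem hy, enorm_eq_ofReal',
        ENNReal.ofReal_rpow_of_pos hx0]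
      apply ENNReal.ofReal_le_ofReal
      rw [Subsingleton.elim y.2 0, norm_zero, dist_eq_norm, ← Real.rpow_natCast ‖x - y.1‖ 2]
      simp only [ne_eq, OfNat.ofNat_ne_zero, not_false_eq_true, zero_pow, add_zero, mul_one]
      rw [← Real.rpow_mul hx0.le, one_div, ← Real.rpow_neg hx0.le]
      apply Real.rpow_le_rpow_of_exponent_ge hx0 hb1.le
      push_cast; linarith
    · rw [indicator_of_notMem hb]; exact zero_le
  refine le_trans (le_of_eq ?_) (lintegral_mono hin)
  rw [lintegral_indicator hSm, lintegral_const, Measure.restrict_apply_univ, ENNReal.top_mul hS0]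

lemma neg_part_pos (m k : ℕ) (hk : 1 ≤ k) (p r lam : ℝ) (hr : 1 < r) (hlam0 : 0 < lam)
    (hlam : (m : ℝ) + k - k / r ≤ lam) (C : ℝ)
    (h : ∀ (f : EuclideanSpace ℝ (Fin m) → ℝ)
          (g : EuclideanSpace ℝ (Fin m) × EuclideanSpace ℝ (Fin k) → ℝ),
          Measurable f → Measurable g → (∀ x, 0 ≤ f x) → (∀ y, 0 ≤ g y) →
          ∫⁻ y : EuclideanSpace ℝ (Fin m) × EuclideanSpace ℝ (Fin k),
              ∫⁻ x, ENNReal.ofReal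
                (f x * g y / (dist x y.1 ^ 2 + ‖y.2‖ ^ 2) ^ (lam / 2))
            ≤ ENNReal.ofReal C * eLpNorm f (ENNReal.ofReal p) volume *
                eLpNorm g (ENNReal.ofReal r) volume) : False := by
  have hr0 : 0 < r := by linarith
  have hr1 : 1 / r < 1 := by rw [div_lt_one hr0]; exact hr
  have hs : 0 < 1 - 1 / r := by linarith
  set f : EuclideanSpace ℝ (Fin m) → ℝ := (Metric.ball 0 2).indicator fun _ => 1 with hf
  set M := ENNReal.ofReal C * eLpNorm f (ENNReal.ofReal p) volume with hM
  have hMt : M ≠ ⊤ := ENNReal.mul_ne_top (by simp) (eLp_ball m p)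
  set ω := volume (Metric.ball (0 : EuclideanSpace ℝ (Fin m)) 1) with hω
  have hωt : ω ≠ ⊤ := measure_ball_lt_top.ne
  have hω0 : ω ≠ 0 := (Metric.measure_ball_pos _ _ one_pos).ne'
  set c := ENNReal.ofReal (2 ^ (-lam / 2)) * ω with hc
  have hct : c ≠ ⊤ := ENNReal.mul_ne_top (by simp) hωt
  have hc0 : c ≠ 0 := mul_ne_zero (by simp; positivity) hω0
  have hbt : (M / c) ^ (1 / (1 - 1 / r)) / ω ≠ ⊤ := by
    refine ENNReal.div_ne_top (ENNReal.rpow_ne_top_of_nonneg (by positivity) ?_) hω0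
    exact ENNReal.div_ne_top hMt hc0
  obtain ⟨δ, hδ, hL⟩ := shell_sup k hk _ hbt
  set T : Set (EuclideanSpace ℝ (Fin k)) := {u | δ ≤ ‖u‖ ∧ ‖u‖ < 1} with hT
  have hTm : MeasurableSet T := (measurableSet_le measurable_const measurable_norm).inter
      (measurableSet_lt measurable_norm measurable_const)
  set W : EuclideanSpace ℝ (Fin k) → ℝ≥0∞ := T.indicator (fun u => ‖u‖ₑ ^ (-(k : ℝ))) with hW
  have hWm : Measurable W := Measurable.indicator (by fun_prop) hTm
  set L := ∫⁻ u, W u with hLdef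
  have hLt : L ≠ ⊤ := by
    have : L ≤ ∫⁻ u, (Metric.ball (0 : EuclideanSpace ℝ (Fin k)) 1).indicator
        (fun _ => ENNReal.ofReal (δ ^ (-(k : ℝ)))) u := by
      refine lintegral_mono fun u => ?_
      by_cases hu : u ∈ T
      · have hu0 : 0 < ‖u‖ := lt_of_lt_of_le hδ hu.1
        rw [hW, indicator_of_mem hu, indicator_of_mem (by simpa using hu.2), enorm_eq_ofReal',
          ENNReal.ofReal_rpow_of_pos hu0]
        apply ENNReal.ofReal_le_ofReal
        exact Real.rpow_le_rpow_of_nonpos hδ hu.1 (by simp)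
      · rw [hW, indicator_of_notMem hu]; exact zero_le
    refine ne_top_of_le_ne_top ?_ this
    rw [lintegral_indicator measurableSet_ball, lintegral_const, Measure.restrict_apply_univ]
    exact ENNReal.mul_ne_top (by simp) measure_ball_lt_top.ne
  set B : EuclideanSpace ℝ (Fin m) → ℝ≥0∞ := (Metric.ball 0 1).indicator (fun _ => 1) with hB
  have hBm : Measurable B := measurable_const.indicator measurableSet_ball
  set S : Set (EuclideanSpace ℝ (Fin m) × EuclideanSpace ℝ (Fin k)) :=
    Metric.ball 0 1 ×ˢ T with hS
  have hSm : MeasurableSet S := measurableSet_ball.prod hTm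
  set g : EuclideanSpace ℝ (Fin m) × EuclideanSpace ℝ (Fin k) → ℝ :=
    S.indicator fun y => ‖y.2‖ ^ (-(k / r)) with hg
  have hgm : Measurable g := Measurable.indicator (by fun_prop) hSm
  have hBW : ∀ y, B y.1 * W y.2 = S.indicator (fun y => ‖y.2‖ₑ ^ (-(k : ℝ))) y := by
    intro y
    by_cases h1 : y.1 ∈ Metric.ball (0 : EuclideanSpace ℝ (Fin m)) 1
    · by_cases h2 : y.2 ∈ T
      · rw [hB, hW, indicator_of_mem h1, indicator_of_mem h2, indicator_of_mem (s := S) ⟨h1, h2⟩,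
          one_mul]
      · rw [hW, indicator_of_notMem h2, indicator_of_notMem (fun hh => h2 hh.2), mul_zero]
    · rw [hB, indicator_of_notMem h1, indicator_of_notMem (fun hh => h1 hh.1), zero_mul]
  have hint : ∫⁻ y : EuclideanSpace ℝ (Fin m) × EuclideanSpace ℝ (Fin k), B y.1 * W y.2 = ω * L := by
    rw [Measure.volume_eq_prod, lintegral_prod_mul hBm.aemeasurable hWm.aemeasurable]
    congr 1
    rw [hB, lintegral_indicator measurableSet_ball]; simp [hω]
  have hgn : eLpNorm g (ENNReal.ofReal r) volume = (ω * L) ^ (1 / r) := by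
    rw [eLpNorm_eq_lintegral_rpow_enorm_toReal (by simpa using hr0) (by simp),
      ENNReal.toReal_ofReal hr0.le, ← hint]
    congr 1
    refine lintegral_congr fun y => ?_
    rw [hBW]
    by_cases hy : y ∈ S
    · have hy0 : 0 < ‖y.2‖ := lt_of_lt_of_le hδ hy.2.1
      rw [hg, indicator_of_mem hy, indicator_of_mem hy, Real.enorm_of_nonneg (by positivity),
        ← ENNReal.ofReal_rpow_of_pos hy0, ← ENNReal.rpow_mul, enorm_eq_ofReal']
      congr 1; field_simp
    · rw [hg, indicator_of_notMem hy, indicator_of_notMem hy]; simp [hr0]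
  have hin : ∀ y, c * (B y.1 * W y.2) ≤ ∫⁻ x, ENNReal.ofReal
      (f x * g y / (dist x y.1 ^ 2 + ‖y.2‖ ^ 2) ^ (lam / 2)) := by
    intro y
    rw [hBW]
    by_cases hy : y ∈ S
    swap
    · rw [indicator_of_notMem hy, mul_zero]; exact zero_le
    have hy0 : 0 < ‖y.2‖ := lt_of_lt_of_le hδ hy.2.1
    have hy1 : ‖y.2‖ < 1 := hy.2.2
    have hy2 : ‖y.1‖ < 1 := by simpa using hy.1
    have step : ∀ x, (Metric.ball y.1 ‖y.2‖).indicator (fun _ => ENNReal.ofReal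
        (‖y.2‖ ^ (-(k / r)) * (2 * ‖y.2‖ ^ 2) ^ (-lam / 2))) x ≤ ENNReal.ofReal
        (f x * g y / (dist x y.1 ^ 2 + ‖y.2‖ ^ 2) ^ (lam / 2)) := by
      intro x
      by_cases hx : x ∈ Metric.ball y.1 ‖y.2‖
      swap
      · rw [indicator_of_notMem hx]; exact zero_le
      rw [indicator_of_mem hx]
      have hd : dist x y.1 < ‖y.2‖ := hx
      have hx2 : x ∈ Metric.ball (0 : EuclideanSpace ℝ (Fin m)) 2 := by
        rw [Metric.mem_ball]
        calc dist x 0 ≤ dist x y.1 + dist y.1 0 := dist_triangle _ _ _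
          _ < 2 := by rw [dist_zero_right]; linarith
      apply ENNReal.ofReal_le_ofReal
      rw [hf, hg, indicator_of_mem hx2, indicator_of_mem hy, one_mul,
        div_eq_mul_inv (‖y.2‖ ^ (-(k / r))),
        ← Real.rpow_neg (by positivity), show -(lam / 2) = -lam / 2 by ring]
      apply mul_le_mul_of_nonneg_left _ (by positivity)
      apply Real.rpow_le_rpow_of_nonpos (by positivity) _ (by linarith)
      have := dist_nonneg (x := x) (y := y.1)
      nlinarith
    refine le_trans ?_ (lintegral_mono step)
    rw [lintegral_indicator measurableSet_ball, lintegral_const, Measure.restrict_apply_univ,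
      indicator_of_mem hy, Measure.addHaar_ball_of_pos _ _ hy0, finrank_euclideanSpace_fin, ← hω,
      hc, ← mul_assoc, mul_right_comm _ ω, enorm_eq_ofReal', ENNReal.ofReal_rpow_of_pos hy0,
      ← ENNReal.ofReal_mul (by positivity), ← ENNReal.ofReal_mul (by positivity)]
    refine mul_le_mul_left (ENNReal.ofReal_le_ofReal ?_) _
    rw [Real.mul_rpow (by positivity) (by positivity), ← Real.rpow_natCast ‖y.2‖ 2,
      ← Real.rpow_mul hy0.le, ← Real.rpow_natCast ‖y.2‖ m]
    have e : ‖y.2‖ ^ (-(k / r)) * (2 ^ (-lam / 2) * ‖y.2‖ ^ (((2 : ℕ) : ℝ) * (-lam / 2))) *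
        ‖y.2‖ ^ (m : ℝ) = 2 ^ (-lam / 2) * ‖y.2‖ ^ (-(k / r) - lam + m) := by
      have : -(k / r) - lam + m = -(k / r) + ((2 : ℕ) : ℝ) * (-lam / 2) + m := by push_cast; ring
      rw [this, Real.rpow_add hy0, Real.rpow_add hy0]; ring
    rw [e]
    gcongr ?_ * ?_
    apply Real.rpow_le_rpow_of_exponent_ge hy0 hy1.le
    linarith
  have key := h f g (measurable_const.indicator measurableSet_ball) hgm
    (indicator_nonneg fun _ _ => zero_le_one) (indicator_nonneg fun _ _ => by positivity)
  have key2 : c * (ω * L) ≤ M * (ω * L) ^ (1 / r) := by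
    rw [← hint, ← lintegral_const_mul' _ _ hct, hint, ← hgn]
    exact (lintegral_mono hin).trans key
  set X := ω * L with hX
  have hXt : X ≠ ⊤ := ENNReal.mul_ne_top hωt hLt
  have hL0 : L ≠ 0 := (lt_of_le_of_lt zero_le hL).ne'
  have hX0 : X ≠ 0 := mul_ne_zero hω0 hL0
  have h5 : X ^ (1 - 1 / r) ≤ M / c := by
    rw [ENNReal.le_div_iff_mul_le (Or.inl hc0) (Or.inl hct),
      ENNReal.rpow_sub _ _ hX0 hXt, ENNReal.rpow_one]
    have hXr0 : X ^ (1 / r) ≠ 0 := by simp [ENNReal.rpow_eq_zero_iff, hX0, hXt]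
    have hXrt : X ^ (1 / r) ≠ ⊤ := by simp [ENNReal.rpow_eq_top_iff, hX0, hXt]
    rw [mul_comm, ← mul_div_assoc, ENNReal.div_le_iff hXr0 hXrt]
    exact key2
  have h6 : X ≤ (M / c) ^ (1 / (1 - 1 / r)) := by
    have := ENNReal.rpow_le_rpow h5 (z := 1 / (1 - 1 / r)) (by positivity)
    rwa [← ENNReal.rpow_mul, mul_one_div_cancel hs.ne', ENNReal.rpow_one] at this
  refine absurd hL (not_lt.2 ?_)
  rw [ENNReal.le_div_iff_mul_le (Or.inl hω0) (Or.inl hωt), mul_comm]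
  exact h6

theorem stmt_10 (n k : ℕ) (hn : 1 ≤ n) (hkn : k < n) (p r lam : ℝ)
    (hp : 1 < p) (hr : 1 < r)
    (hbal : ((n : ℝ) - k) / n * (1 / p) + 1 / r + lam / n = 2 - k / n) :
    (0 < lam → lam < (n : ℝ) - k / r →
      ∃ C : ℝ, 0 < C ∧
        ∀ (f : EuclideanSpace ℝ (Fin (n - k)) → ℝ)
          (g : EuclideanSpace ℝ (Fin (n - k)) × EuclideanSpace ℝ (Fin k) → ℝ),
          Measurable f → Measurable g → (∀ x, 0 ≤ f x) → (∀ y, 0 ≤ g y) →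
          ∫⁻ y : EuclideanSpace ℝ (Fin (n - k)) × EuclideanSpace ℝ (Fin k),
              ∫⁻ x, ENNReal.ofReal
                (f x * g y / (dist x y.1 ^ 2 + ‖y.2‖ ^ 2) ^ (lam / 2))
            ≤ ENNReal.ofReal C * eLpNorm f (ENNReal.ofReal p) volume *
                eLpNorm g (ENNReal.ofReal r) volume) ∧
    ((n : ℝ) - k / r ≤ lam →
      ¬ ∃ C : ℝ, 0 < C ∧
        ∀ (f : EuclideanSpace ℝ (Fin (n - k)) → ℝ)
          (g : EuclideanSpace ℝ (Fin (n - k)) × EuclideanSpace ℝ (Fin k) → ℝ),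
          Measurable f → Measurable g → (∀ x, 0 ≤ f x) → (∀ y, 0 ≤ g y) →
          ∫⁻ y : EuclideanSpace ℝ (Fin (n - k)) × EuclideanSpace ℝ (Fin k),
              ∫⁻ x, ENNReal.ofReal
                (f x * g y / (dist x y.1 ^ 2 + ‖y.2‖ ^ 2) ^ (lam / 2))
            ≤ ENNReal.ofReal C * eLpNorm f (ENNReal.ofReal p) volume *
                eLpNorm g (ENNReal.ofReal r) volume) := by
  have hr0 : 0 < r := by linarith
  have hp0 : 0 < p := by linarith
  have hn0 : (0 : ℝ) < n := by exact_mod_cast hn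
  have hm : 1 ≤ n - k := by omega
  have hcast : ((n - k : ℕ) : ℝ) = n - k := Nat.cast_sub hkn.le
  refine ⟨fun _ hlt => ?_, ?_⟩
  · refine pos_part (n - k) k hm p r lam hp hr ?_ (by rw [hcast]; linarith)
    rw [hcast]
    have h1 : (n : ℝ) * (((n : ℝ) - k) / n * (1 / p) + 1 / r + lam / n) = n * (2 - k / n) := by
      rw [hbal]
    have e1 : (n : ℝ) * (((n : ℝ) - k) / n * (1 / p) + 1 / r + lam / n) =
        (n - k) / p + n / r + lam := by field_simp
    have e2 : (n : ℝ) * (2 - k / n) = 2 * n - k := by field_simp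
    rw [e1, e2] at h1
    rw [show (n : ℝ) - k + k = n by ring]
    linarith
  · rintro hge ⟨C, -, hC⟩
    rcases Nat.eq_zero_or_pos k with rfl | hk
    · exact neg_part_zero (n - 0) hm p r lam (by simpa using hge) C hC
    · have hkr : (k : ℝ) / r ≤ k := div_le_self (Nat.cast_nonneg k) hr.le
      have hkn' : (k : ℝ) < n := by exact_mod_cast hkn
      exact neg_part_pos (n - k) k hk p r lam hr (by linarith) (by rw [hcast]; linarith) C hC
end
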